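/- arXiv:2212.13112 — 3 statements merged into one kernel-verified Lean document; each statement's English description precedes it below -/
import Mathlib

section
/- Let n ≥ 2 be an integer and m ∈ {0,…,2^n}. If m ∈ {0,…,2^{n−2}} then Φ(n,m) = 2·Φ(n−2,m) + m, and if m ∈ {2^{n−2}+1,…,2^n} then Φ(n,m) = 2^n − s, where s is the greatest element of {0,…,2^{n−2}} such that Φ(n,s) ≤ 2^n − m. Moreover (Φ(0,0),Φ(0,1)) = (0,1) and (Φ(1,0),Φ(1,1),Φ(1,2)) = (0,2,2). -/
open Finset

/-- The ground set `[n] = {1, …, n}`. -/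
def groundSet (n : ℕ) : Finset ℕ := Finset.Icc 1 n

/-- The up-closure `𝓕↑` of a family `F` with respect to ground set `X`. -/
def upClo (X : Finset ℕ) (F : Finset (Finset ℕ)) : Finset (Finset ℕ) :=
  X.powerset.filter (fun S => ∃ A ∈ F, A ⊆ S)

/-- The down-closure `𝓕↓` of a family `F` with respect to ground set `X`. -/
def downClo (X : Finset ℕ) (F : Finset (Finset ℕ)) : Finset (Finset ℕ) :=
  X.powerset.filter (fun S => ∃ A ∈ F, S ⊆ A)

/-- `𝓕↕ = 𝓕↑ ∪ 𝓕↓` with respect to ground set `X`. -/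
def udClo (X : Finset ℕ) (F : Finset (Finset ℕ)) : Finset (Finset ℕ) :=
  upClo X F ∪ downClo X F

/-- `Φ(n,m)`: the minimum of `|𝓕↕|` over families `𝓕 ⊆ 2^[n]` with `|𝓕| = m`,
closures taken w.r.t. the ground set `[n]`. -/
noncomputable def Phi (n m : ℕ) : ℕ :=
  sInf {k | ∃ F : Finset (Finset ℕ),
    F ⊆ (groundSet n).powerset ∧ F.card = m ∧ (udClo (groundSet n) F).card = k}

/-- `crossCount n u v` counts the `x < u` below `2 ^ n` whose `n`-bit reversal is below `v`; it is
the least intersection size of two down-sets of sizes `u` and `v` in the cube of dimension `n`. -/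
def crossCount : ℕ → ℕ → ℕ → ℕ
  | 0, u, v => min (min u v) 1
  | n + 1, u, v => crossCount n (min u (2 ^ n)) ((v + 1) / 2) + crossCount n (u - 2 ^ n) (v / 2)

lemma crossCount_succ_right (n u v : ℕ) : crossCount (n + 1) u v =
    crossCount n ((u + 1) / 2) (min v (2 ^ n)) + crossCount n (u / 2) (v - 2 ^ n) := by
  induction n generalizing u v with
  | zero => simp only [crossCount]; omega
  | succ n ih =>
    have h2 : 2 ^ (n + 1) = 2 * 2 ^ n := by ring
    rw [crossCount, ih, ih, crossCount, crossCount, h2]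
    have e1 : (min u (2 * 2 ^ n) + 1) / 2 = min ((u + 1) / 2) (2 ^ n) := by omega
    have e2 : (min v (2 * 2 ^ n) + 1) / 2 = min ((v + 1) / 2) (2 ^ n) := by omega
    have e3 : min u (2 * 2 ^ n) / 2 = min (u / 2) (2 ^ n) := by omega
    have e4 : min v (2 * 2 ^ n) / 2 = min (v / 2) (2 ^ n) := by omega
    have e5 : (u - 2 * 2 ^ n + 1) / 2 = (u + 1) / 2 - 2 ^ n := by omega
    have e6 : (v - 2 * 2 ^ n + 1) / 2 = (v + 1) / 2 - 2 ^ n := by omega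
    have e7 : (u - 2 * 2 ^ n) / 2 = u / 2 - 2 ^ n := by omega
    have e8 : (v - 2 * 2 ^ n) / 2 = v / 2 - 2 ^ n := by omega
    rw [e1, e2, e3, e4, e5, e6, e7, e8]
    omega

lemma crossCount_comm (n u v : ℕ) : crossCount n u v = crossCount n v u := by
  induction n generalizing u v with
  | zero => simp only [crossCount]; omega
  | succ n ih => rw [crossCount, crossCount_succ_right, ih, ih (u - 2 ^ n)]

lemma crossCount_mono_left (n v : ℕ) {u u' : ℕ} (h : u ≤ u') :
    crossCount n u v ≤ crossCount n u' v := by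
  induction n generalizing u u' v with
  | zero => simp only [crossCount]; omega
  | succ n ih =>
    rw [crossCount, crossCount]
    exact add_le_add (ih _ (by omega)) (ih _ (by omega))

@[simp] lemma crossCount_zero_left (n v : ℕ) : crossCount n 0 v = 0 := by
  induction n generalizing v with
  | zero => simp [crossCount]
  | succ n ih => simp [crossCount, ih]

@[simp] lemma crossCount_zero_right (n u : ℕ) : crossCount n u 0 = 0 := by
  rw [crossCount_comm, crossCount_zero_left]

lemma crossCount_two_pow_left (n v : ℕ) (hv : v ≤ 2 ^ n) : crossCount n (2 ^ n) v = v := by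
  induction n generalizing v with
  | zero => simp only [crossCount]; omega
  | succ n ih =>
    have h2 : 2 ^ (n + 1) = 2 * 2 ^ n := by ring
    rw [crossCount, show min (2 ^ (n + 1)) (2 ^ n) = 2 ^ n by omega,
      show 2 ^ (n + 1) - 2 ^ n = 2 ^ n by omega, ih _ (by omega), ih _ (by omega)]
    omega

lemma crossCount_two_pow_right (n u : ℕ) (hu : u ≤ 2 ^ n) : crossCount n u (2 ^ n) = u := by
  rw [crossCount_comm, crossCount_two_pow_left n u hu]

/-- The Harris–Kleitman bound for `crossCount`. -/
lemma mul_le_two_pow_mul_crossCount (n u v : ℕ) (hu : u ≤ 2 ^ n) (hv : v ≤ 2 ^ n) :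
    u * v ≤ 2 ^ n * crossCount n u v := by
  induction n generalizing u v with
  | zero =>
    simp only [pow_zero] at hu hv
    interval_cases u <;> interval_cases v <;> simp [crossCount]
  | succ n ih =>
    have h2 : 2 ^ (n + 1) = 2 * 2 ^ n := by ring
    rw [h2] at hu hv
    have i1 := ih (min u (2 ^ n)) ((v + 1) / 2) (by omega) (by omega)
    have i2 := ih (u - 2 ^ n) (v / 2) (by omega) (by omega)
    rw [crossCount, h2]
    obtain ⟨a, ha, b, hb, hab⟩ : ∃ a, a = (v + 1) / 2 ∧ ∃ b, b = v / 2 ∧ b ≤ a :=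
      ⟨_, rfl, _, rfl, by omega⟩
    have hv' : v = a + b := by omega
    rw [← ha] at i1 ⊢
    rw [← hb] at i2 ⊢
    rcases le_total u (2 ^ n) with h | h
    · rw [min_eq_left h] at i1 ⊢
      rw [hv']
      nlinarith [Nat.mul_le_mul_left u hab]
    · rw [min_eq_right h] at i1 ⊢
      obtain ⟨w, rfl⟩ := Nat.exists_eq_add_of_le h
      rw [Nat.add_sub_cancel_left] at i2 ⊢
      rw [hv']
      have hw : w ≤ 2 ^ n := by omega
      nlinarith [mul_le_mul' (le_refl (a - b)) hw, Nat.sub_add_cancel hab]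

/-- Splitting both halves along another coordinate and merging the pieces the other way. -/
lemma crossCount_add_regroup {n : ℕ}
    (ih : ∀ u₀ u₁ v₀ v₁ : ℕ, u₀ ≤ u₁ → u₁ ≤ 2 ^ n → v₀ ≤ v₁ → v₁ ≤ 2 ^ n →
      crossCount (n + 1) (u₀ + u₁) (v₀ + v₁) ≤ crossCount n u₀ v₀ + crossCount n u₁ v₁)
    {u₀ u₁ v₀ v₁ : ℕ} (hu : u₀ ≤ u₁) (hu₁ : u₁ ≤ 2 * 2 ^ n) (hv : v₀ ≤ v₁)
    (hv₁ : v₁ ≤ 2 * 2 ^ n) :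
    crossCount (n + 1) (u₀ / 2 + u₁ / 2) (v₀ - 2 ^ n + (v₁ - 2 ^ n)) +
      crossCount (n + 1) ((u₀ + 1) / 2 + (u₁ + 1) / 2) (min v₀ (2 ^ n) + min v₁ (2 ^ n)) ≤
    crossCount (n + 1) u₀ v₀ + crossCount (n + 1) u₁ v₁ := by
  have i1 := ih (u₀ / 2) (u₁ / 2) (v₀ - 2 ^ n) (v₁ - 2 ^ n) (by omega) (by omega) (by omega)
    (by omega)
  have i2 := ih ((u₀ + 1) / 2) ((u₁ + 1) / 2) (min v₀ (2 ^ n)) (min v₁ (2 ^ n)) (by omega)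
    (by omega) (by omega) (by omega)
  rw [crossCount_succ_right n u₀, crossCount_succ_right n u₁]
  omega

lemma crossCount_le_add_of_eq_two_pow {n u₀ u₁ v₀ v₁ : ℕ} (hu : u₀ ≤ u₁) (hu₁ : u₁ ≤ 2 ^ n)
    (hv : v₀ ≤ v₁) (hv₁ : v₁ ≤ 2 ^ n) (h : u₀ + u₁ = 2 ^ n) :
    crossCount (n + 1) (u₀ + u₁) (v₀ + v₁) ≤ crossCount n u₀ v₀ + crossCount n u₁ v₁ := by
  have k0 := mul_le_two_pow_mul_crossCount n u₀ v₀ (by omega) (by omega)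
  have k1 := mul_le_two_pow_mul_crossCount n u₁ v₁ hu₁ hv₁
  have key : 2 ^ n * (v₀ + v₁) ≤ 2 ^ n * (2 * (crossCount n u₀ v₀ + crossCount n u₁ v₁)) := by
    rw [← h] at k0 k1 ⊢
    obtain ⟨p, rfl⟩ := Nat.exists_eq_add_of_le hu
    obtain ⟨q, rfl⟩ := Nat.exists_eq_add_of_le hv
    nlinarith [Nat.zero_le (p * q)]
  have := Nat.le_of_mul_le_mul_left key (by positivity)
  rw [crossCount, h, min_self, Nat.sub_self, crossCount_zero_left,
    crossCount_two_pow_left _ _ (by omega)]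
  omega

lemma crossCount_succ_le_add (n u₀ u₁ v₀ v₁ : ℕ) (hu : u₀ ≤ u₁) (hu₁ : u₁ ≤ 2 ^ n)
    (hv : v₀ ≤ v₁) (hv₁ : v₁ ≤ 2 ^ n) :
    crossCount (n + 1) (u₀ + u₁) (v₀ + v₁) ≤ crossCount n u₀ v₀ + crossCount n u₁ v₁ := by
  induction n generalizing u₀ u₁ v₀ v₁ with
  | zero =>
    simp only [crossCount, pow_zero] at *
    omega
  | succ n ih =>
    by_cases hU : u₀ + u₁ = 2 ^ (n + 1)
    · exact crossCount_le_add_of_eq_two_pow hu hu₁ hv hv₁ hU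
    by_cases hV : v₀ + v₁ = 2 ^ (n + 1)
    · rw [crossCount_comm _ (u₀ + u₁), crossCount_comm _ u₀, crossCount_comm _ u₁]
      exact crossCount_le_add_of_eq_two_pow hv hv₁ hu hu₁ hV
    have h2 : 2 ^ (n + 1) = 2 * 2 ^ n := by ring
    have hdef := crossCount.eq_2 (u₀ + u₁) (v₀ + v₁) (n + 1)
    rw [h2] at hu₁ hv₁ hU hV hdef
    rw [hdef]
    have swap : ∀ {u₀ u₁ v₀ v₁ : ℕ}, u₀ ≤ u₁ → u₁ ≤ 2 * 2 ^ n → v₀ ≤ v₁ → v₁ ≤ 2 * 2 ^ n →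
        crossCount (n + 1) (u₀ - 2 ^ n + (u₁ - 2 ^ n)) (v₀ / 2 + v₁ / 2) +
          crossCount (n + 1) (min u₀ (2 ^ n) + min u₁ (2 ^ n)) ((v₀ + 1) / 2 + (v₁ + 1) / 2) ≤
        crossCount (n + 1) u₀ v₀ + crossCount (n + 1) u₁ v₁ := by
      intro u₀ u₁ v₀ v₁ h1 h2 h3 h4
      have := crossCount_add_regroup ih h3 h4 h1 h2
      simpa only [crossCount_comm (n + 1)] using this
    have round : ∀ {u₀ u₁ v₀ v₁ : ℕ}, u₀ ≤ u₁ → u₁ ≤ 2 * 2 ^ n → v₀ ≤ v₁ → v₁ ≤ 2 * 2 ^ n →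
        u₀ + u₁ ≠ 2 * 2 ^ n → ∃ v₀' v₁', v₀' ≤ v₁' ∧ v₁' ≤ 2 * 2 ^ n ∧ v₁' ≤ v₀' + 2 ∧
          v₀' + v₁' = v₀ + v₁ ∧
          (v₁ ≤ v₀ + 2 → v₀ + v₁ ≠ 2 * 2 ^ n → v₁' ≤ v₀' + 1) ∧
          crossCount (n + 1) (u₀ + u₁ - 2 * 2 ^ n) v₀' +
            crossCount (n + 1) (min (u₀ + u₁) (2 * 2 ^ n)) v₁' ≤
          crossCount (n + 1) u₀ v₀ + crossCount (n + 1) u₁ v₁ := by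
      intro u₀ u₁ v₀ v₁ h1 h2 h3 h4 h5
      have s1 := crossCount_add_regroup ih h1 h2 h3 h4
      have s2 := swap (u₀ := u₀ / 2 + u₁ / 2) (u₁ := (u₀ + 1) / 2 + (u₁ + 1) / 2)
        (v₀ := v₀ - 2 ^ n + (v₁ - 2 ^ n)) (v₁ := min v₀ (2 ^ n) + min v₁ (2 ^ n))
        (by omega) (by omega) (by omega) (by omega)
      rw [show u₀ / 2 + u₁ / 2 - 2 ^ n + ((u₀ + 1) / 2 + (u₁ + 1) / 2 - 2 ^ n) =
          u₀ + u₁ - 2 * 2 ^ n by omega,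
        show min (u₀ / 2 + u₁ / 2) (2 ^ n) + min ((u₀ + 1) / 2 + (u₁ + 1) / 2) (2 ^ n) =
          min (u₀ + u₁) (2 * 2 ^ n) by omega] at s2
      exact ⟨_, _, by omega, by omega, by omega, by omega, by omega, s2.trans s1⟩
    obtain ⟨a, b, h1, h2, h3, h4, -, h5⟩ := round hu hu₁ hv hv₁ hU
    obtain ⟨c, d, k1, k2, -, k4, k3, k5⟩ := round (u₀ := u₀ + u₁ - 2 * 2 ^ n)
      (u₁ := min (u₀ + u₁) (2 * 2 ^ n)) (by omega) (by omega) h1 h2 (by omega)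
    have hd := k3 h3 (by omega)
    rw [show u₀ + u₁ - 2 * 2 ^ n + min (u₀ + u₁) (2 * 2 ^ n) = u₀ + u₁ by omega] at k5
    rw [show (v₀ + v₁ + 1) / 2 = d by omega, show (v₀ + v₁) / 2 = c by omega]
    omega

section LowerSets

variable {α : Type*} [DecidableEq α]

/-- Two down-sets in a cube of dimension `#s` meet in at least `crossCount` many sets. -/
lemma IsLowerSet.crossCount_le_card_inter {s : Finset α} {A B : Finset (Finset α)}
    (hA : IsLowerSet (A : Set (Finset α))) (hB : IsLowerSet (B : Set (Finset α)))
    (hAs : A ⊆ s.powerset) (hBs : B ⊆ s.powerset) :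
    crossCount #s #A #B ≤ #(A ∩ B) := by
  induction s using Finset.induction generalizing A B with
  | empty =>
    rw [powerset_empty, subset_singleton_iff] at hAs hBs
    rcases hAs with rfl | rfl <;> rcases hBs with rfl | rfl <;> simp [crossCount]
  | insert a s hs ih =>
    have h₀ : ∀ C : Finset (Finset α), C ⊆ (insert a s).powerset →
        C.nonMemberSubfamily a ⊆ s.powerset := by
      intro C hC t ht
      rw [mem_nonMemberSubfamily] at ht
      exact mem_powerset.2 ((subset_insert_iff_of_notMem ht.2).1 (mem_powerset.1 (hC ht.1)))
    have h₁ : ∀ C : Finset (Finset α), C ⊆ (insert a s).powerset →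
        C.memberSubfamily a ⊆ s.powerset := by
      intro C hC t ht
      rw [mem_memberSubfamily] at ht
      exact mem_powerset.2 ((subset_insert_iff_of_notMem ht.2).1
        ((subset_insert _ _).trans (mem_powerset.1 (hC ht.1))))
    have hcard : ∀ C : Finset (Finset α), C ⊆ s.powerset → #C ≤ 2 ^ #s := fun C hC =>
      (card_le_card hC).trans_eq (card_powerset s)
    have i₁ := ih hA.memberSubfamily hB.memberSubfamily (h₁ A hAs) (h₁ B hBs)
    have i₀ := ih hA.nonMemberSubfamily hB.nonMemberSubfamily (h₀ A hAs) (h₀ B hBs)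
    have key := crossCount_succ_le_add #s _ _ _ _
      (card_le_card hA.memberSubfamily_subset_nonMemberSubfamily) (hcard _ (h₀ A hAs))
      (card_le_card hB.memberSubfamily_subset_nonMemberSubfamily) (hcard _ (h₀ B hBs))
    rw [card_memberSubfamily_add_card_nonMemberSubfamily,
      card_memberSubfamily_add_card_nonMemberSubfamily] at key
    rw [card_insert_of_notMem hs, ← card_memberSubfamily_add_card_nonMemberSubfamily a (A ∩ B),
      memberSubfamily_inter, nonMemberSubfamily_inter]
    omega

/-- The family whose members avoiding `a` form `P` and whose link at `a` is `Q`. -/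
def glueFamily (a : α) (P Q : Finset (Finset α)) : Finset (Finset α) := P ∪ Q.image (insert a)

lemma mem_glueFamily {a : α} {P Q : Finset (Finset α)} {t : Finset α} :
    t ∈ glueFamily a P Q ↔ t ∈ P ∨ ∃ q ∈ Q, insert a q = t := by
  simp [glueFamily]

lemma memberSubfamily_glueFamily {a : α} {P Q : Finset (Finset α)} (hP : ∀ t ∈ P, a ∉ t)
    (hQ : ∀ t ∈ Q, a ∉ t) : (glueFamily a P Q).memberSubfamily a = Q := by
  rw [glueFamily, memberSubfamily_union, memberSubfamily_image_insert hQ]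
  have : P.memberSubfamily a = ∅ := by
    refine eq_empty_of_forall_notMem fun t ht => ?_
    rw [mem_memberSubfamily] at ht
    exact hP _ ht.1 (mem_insert_self a t)
  rw [this, empty_union]

lemma nonMemberSubfamily_glueFamily {a : α} {P Q : Finset (Finset α)} (hP : ∀ t ∈ P, a ∉ t) :
    (glueFamily a P Q).nonMemberSubfamily a = P := by
  ext t
  rw [mem_nonMemberSubfamily, mem_glueFamily]
  constructor
  · rintro ⟨h | ⟨q, -, rfl⟩, ha⟩
    · exact h
    · exact absurd (mem_insert_self a q) ha
  · exact fun h => ⟨Or.inl h, hP t h⟩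

lemma card_glueFamily {a : α} {P Q : Finset (Finset α)} (hP : ∀ t ∈ P, a ∉ t)
    (hQ : ∀ t ∈ Q, a ∉ t) : #(glueFamily a P Q) = #Q + #P := by
  rw [← card_memberSubfamily_add_card_nonMemberSubfamily a, memberSubfamily_glueFamily hP hQ,
    nonMemberSubfamily_glueFamily hP]

lemma card_glueFamily_inter {a : α} {P Q P' Q' : Finset (Finset α)} (hP : ∀ t ∈ P, a ∉ t)
    (hQ : ∀ t ∈ Q, a ∉ t) (hP' : ∀ t ∈ P', a ∉ t) (hQ' : ∀ t ∈ Q', a ∉ t) :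
    #(glueFamily a P Q ∩ glueFamily a P' Q') = #(Q ∩ Q') + #(P ∩ P') := by
  rw [← card_memberSubfamily_add_card_nonMemberSubfamily a, memberSubfamily_inter,
    nonMemberSubfamily_inter, memberSubfamily_glueFamily hP hQ, memberSubfamily_glueFamily hP' hQ',
    nonMemberSubfamily_glueFamily hP, nonMemberSubfamily_glueFamily hP']

lemma glueFamily_mono (a : α) {P Q P' Q' : Finset (Finset α)} (hP : P ⊆ P') (hQ : Q ⊆ Q') :
    glueFamily a P Q ⊆ glueFamily a P' Q' :=
  union_subset_union hP (image_subset_image hQ)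

lemma isLowerSet_glueFamily {a : α} {P Q : Finset (Finset α)}
    (hP : IsLowerSet (P : Set (Finset α))) (hQ : IsLowerSet (Q : Set (Finset α))) (hQP : Q ⊆ P) :
    IsLowerSet (glueFamily a P Q : Set (Finset α)) := by
  intro t r hrt ht
  rw [mem_coe, mem_glueFamily] at ht ⊢
  rcases ht with ht | ⟨q, hq, rfl⟩
  · exact Or.inl (hP hrt ht)
  · by_cases ha : a ∈ r
    · exact Or.inr ⟨r.erase a, hQ (subset_insert_iff.1 hrt) hq, insert_erase ha⟩
    · exact Or.inl (hP ((subset_insert_iff_of_notMem ha).1 hrt) (hQP hq))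

lemma glueFamily_subset_powerset {a : α} {s : Finset α} {P Q : Finset (Finset α)}
    (hP : P ⊆ s.powerset) (hQ : Q ⊆ s.powerset) :
    glueFamily a P Q ⊆ (insert a s).powerset := by
  intro t ht
  rw [mem_powerset]
  rcases mem_glueFamily.1 ht with ht | ⟨q, hq, rfl⟩
  · exact (mem_powerset.1 (hP ht)).trans (subset_insert a s)
  · exact insert_subset_insert a (mem_powerset.1 (hQ hq))

/-- An increasing chain of down-sets in the cube on `s`, one of each size. -/
structure IsLowerChain (s : Finset α) (A : ℕ → Finset (Finset α)) : Prop where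
  isLowerSet (i : ℕ) : IsLowerSet (A i : Set (Finset α))
  mono : Monotone A
  subset_powerset (i : ℕ) : A i ⊆ s.powerset
  card_eq (i : ℕ) (hi : i ≤ 2 ^ #s) : #(A i) = i

lemma IsLowerChain.notMem {β : Type*} {s : Finset β} {A : ℕ → Finset (Finset β)}
    (hA : IsLowerChain s A) {a : β} (ha : a ∉ s) (i : ℕ) : ∀ t ∈ A i, a ∉ t := fun _ ht h =>
  ha (mem_powerset.1 (hA.subset_powerset i ht) h)

lemma IsLowerChain.glueFamily {s : Finset α} {A : ℕ → Finset (Finset α)} (hA : IsLowerChain s A)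
    {a : α} (ha : a ∉ s) {f g : ℕ → ℕ} (hf : Monotone f) (hg : Monotone g) (hgf : ∀ i, g i ≤ f i)
    (hfg : ∀ i ≤ 2 * 2 ^ #s, f i ≤ 2 ^ #s ∧ g i + f i = i) :
    IsLowerChain (insert a s) fun i => glueFamily a (A (f i)) (A (g i)) where
  isLowerSet i := isLowerSet_glueFamily (hA.isLowerSet _) (hA.isLowerSet _) (hA.mono (hgf i))
  mono _ _ h := glueFamily_mono a (hA.mono (hf h)) (hA.mono (hg h))
  subset_powerset i := glueFamily_subset_powerset (hA.subset_powerset _) (hA.subset_powerset _)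
  card_eq i hi := by
    rw [card_insert_of_notMem ha, pow_succ'] at hi
    obtain ⟨h1, h2⟩ := hfg i hi
    rw [card_glueFamily (hA.notMem ha _) (hA.notMem ha _), hA.card_eq _ h1,
      hA.card_eq _ ((hgf i).trans h1), h2]

/-- The bound `IsLowerSet.crossCount_le_card_inter` is attained for all sizes by two chains. -/
lemma exists_isLowerChain_card_inter_eq (s : Finset α) :
    ∃ A B : ℕ → Finset (Finset α), IsLowerChain s A ∧ IsLowerChain s B ∧
      ∀ i ≤ 2 ^ #s, ∀ j ≤ 2 ^ #s, #(A i ∩ B j) = crossCount #s i j := by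
  induction s using Finset.induction with
  | empty =>
    have h : IsLowerChain (∅ : Finset α) fun i => if i = 0 then ∅ else {∅} := by
      refine ⟨fun i => ?_, fun i j hij => ?_, fun i => ?_, fun i hi => ?_⟩
      · intro t r hrt ht
        by_cases h : i = 0
        · simp [h] at ht
        · simp only [h, if_false, coe_singleton, Set.mem_singleton_iff] at ht ⊢
          subst ht
          exact subset_empty.1 hrt
      · by_cases h : i = 0
        · simp [h]
        · simp [h, show j ≠ 0 by omega]
      · by_cases h : i = 0 <;> simp [h]
      · rw [card_empty, pow_zero] at hi
        interval_cases i <;> simp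
    refine ⟨_, _, h, h, fun i hi j hj => ?_⟩
    rw [card_empty, pow_zero] at hi hj
    interval_cases i <;> interval_cases j <;> simp [crossCount]
  | insert a s hs ih =>
    obtain ⟨A, B, hA, hB, hAB⟩ := ih
    refine ⟨_, _,
      hA.glueFamily hs (f := fun i => min i (2 ^ #s)) (g := fun i => min (i - 2 ^ #s) (2 ^ #s))
        ?_ ?_ ?_ ?_,
      hB.glueFamily hs (f := fun i => (i + 1) / 2) (g := fun i => i / 2) ?_ ?_ ?_ ?_, ?_⟩
    · intro i j h; dsimp only; omega
    · intro i j h; dsimp only; omega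
    · intro i; omega
    · intro i h; omega
    · intro i j h; dsimp only; omega
    · intro i j h; dsimp only; omega
    · intro i; omega
    · intro i h; omega
    · intro i hi j hj
      rw [card_insert_of_notMem hs, pow_succ'] at hi hj
      rw [card_glueFamily_inter (hA.notMem hs _) (hA.notMem hs _) (hB.notMem hs _)
        (hB.notMem hs _), hAB _ (by omega) _ (by omega), hAB _ (by omega) _ (by omega),
        card_insert_of_notMem hs, crossCount, add_comm,
        min_eq_left (show i - 2 ^ #s ≤ 2 ^ #s by omega)]

end LowerSets

lemma card_groundSet (n : ℕ) : #(groundSet n) = n := by simp [groundSet]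

lemma card_powerset_groundSet (n : ℕ) : #(groundSet n).powerset = 2 ^ n := by
  rw [card_powerset, card_groundSet]

lemma exists_card_udClo_eq_Phi {n m : ℕ} (hm : m ≤ 2 ^ n) :
    ∃ F ⊆ (groundSet n).powerset, #F = m ∧ #(udClo (groundSet n) F) = Phi n m := by
  obtain ⟨F, hF, hFm⟩ := exists_subset_card_eq (hm.trans_eq (card_powerset_groundSet n).symm)
  exact Nat.sInf_mem (s := {k | ∃ F : Finset (Finset ℕ), F ⊆ (groundSet n).powerset ∧
    F.card = m ∧ (udClo (groundSet n) F).card = k}) ⟨_, F, hF, hFm, rfl⟩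

lemma Phi_le_card_udClo {n : ℕ} {F : Finset (Finset ℕ)} (hF : F ⊆ (groundSet n).powerset) :
    Phi n #F ≤ #(udClo (groundSet n) F) :=
  Nat.sInf_le ⟨F, hF, rfl, rfl⟩

lemma upClo_subset_powerset (X : Finset ℕ) (F : Finset (Finset ℕ)) :
    upClo X F ⊆ X.powerset := filter_subset _ _

lemma downClo_subset_powerset (X : Finset ℕ) (F : Finset (Finset ℕ)) :
    downClo X F ⊆ X.powerset := filter_subset _ _

lemma udClo_subset_powerset (X : Finset ℕ) (F : Finset (Finset ℕ)) :
    udClo X F ⊆ X.powerset :=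
  union_subset (upClo_subset_powerset X F) (downClo_subset_powerset X F)

lemma isLowerSet_downClo (X : Finset ℕ) (F : Finset (Finset ℕ)) :
    IsLowerSet (downClo X F : Set (Finset ℕ)) := by
  intro t r hrt ht
  simp only [downClo, coe_filter, mem_powerset, Set.mem_ofPred_eq] at ht ⊢
  obtain ⟨h, A, hA, htA⟩ := ht
  exact ⟨hrt.trans h, A, hA, hrt.trans htA⟩

lemma isLowerSet_powerset_sdiff_upClo (X : Finset ℕ) (F : Finset (Finset ℕ)) :
    IsLowerSet (X.powerset \ upClo X F : Set (Finset ℕ)) := by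
  intro t r hrt ht
  simp only [upClo, coe_filter, Set.mem_sdiff, mem_coe, mem_powerset, Set.mem_ofPred_eq] at ht ⊢
  exact ⟨hrt.trans ht.1, fun ⟨h, A, hA, hAr⟩ => ht.2 ⟨ht.1, A, hA, hAr.trans hrt⟩⟩

/-- The closures of an optimal family give down-sets of sizes `d` and `v` (the second one being the
complement of the up-closure) realising `Phi`. -/
lemma exists_sizes_of_Phi {n m : ℕ} (hm : m ≤ 2 ^ n) :
    ∃ d ≤ 2 ^ n, ∃ v ≤ 2 ^ n, m + crossCount n d v ≤ d ∧ d + 2 ^ n ≤ Phi n m + m + v := by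
  obtain ⟨F, hF, hFm, hPhi⟩ := exists_card_udClo_eq_Phi hm
  set X := groundSet n with hX
  set D := downClo X F
  set U := upClo X F
  have hDX : D ⊆ X.powerset := downClo_subset_powerset X F
  have hUX : U ⊆ X.powerset := upClo_subset_powerset X F
  have hcross := (isLowerSet_downClo X F).crossCount_le_card_inter
    (B := X.powerset \ U) (by rw [coe_sdiff]; exact isLowerSet_powerset_sdiff_upClo X F) hDX
    sdiff_subset
  have hFDU : F ⊆ D ∩ U := fun t ht => by
    simp only [D, U, mem_inter, downClo, upClo, mem_filter]
    exact ⟨⟨hF ht, t, ht, Subset.rfl⟩, hF ht, t, ht, Subset.rfl⟩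
  have hDC : D ∩ (X.powerset \ U) = D \ U := by
    rw [← inter_sdiff_assoc, inter_eq_left.2 hDX]
  have c1 : #(X.powerset \ U) + #U = 2 ^ n := by
    rw [card_sdiff_add_card_eq_card hUX, hX, card_powerset_groundSet]
  have c2 : #(D \ U) + #(D ∩ U) = #D := card_sdiff_add_card_inter D U
  have c3 : #(D \ U) + #U = Phi n m := by
    rw [← hPhi, card_sdiff_add_card, udClo, union_comm]
  have c4 : #D ≤ 2 ^ n := (card_le_card hDX).trans_eq (card_powerset_groundSet n)
  have c5 := card_le_card hFDU
  rw [hDC, hX, card_groundSet, ← hX] at hcross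
  have c6 := crossCount_mono_left n #(X.powerset \ U)
    (show #D - (#(D ∩ U) - m) ≤ #D from Nat.sub_le _ _)
  refine ⟨#D - (#(D ∩ U) - m), by omega, #(X.powerset \ U), by omega, ?_, by omega⟩
  have c7 : crossCount n #D #(X.powerset \ U) ≤ #(D \ U) := hcross
  omega

lemma Phi_add_le_of_sizes {n m d v : ℕ} (hd : d ≤ 2 ^ n) (hv : v ≤ 2 ^ n)
    (h : m + crossCount n d v ≤ d) : Phi n m + m + v ≤ d + 2 ^ n := by
  induction d with
  | zero =>
    obtain rfl : m = 0 := by omega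
    have := Phi_le_card_udClo (n := n) (empty_subset _)
    simp [udClo, upClo, downClo] at this
    omega
  | succ d ih =>
    rcases h.lt_or_eq with hlt | heq
    · have := crossCount_mono_left n v (show d ≤ d + 1 by omega)
      have := ih (by omega) (by omega)
      omega
    obtain ⟨A, B, hA, hB, hAB⟩ := exists_isLowerChain_card_inter_eq (groundSet n)
    rw [card_groundSet] at hAB
    have hc := hAB _ hd _ hv
    set X := groundSet n with hX
    have cA : #(A (d + 1)) = d + 1 := hA.card_eq _ (by rwa [hX, card_groundSet])
    have cB : #(B v) = v := hB.card_eq _ (by rwa [hX, card_groundSet])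
    have c1 : #(A (d + 1) \ B v) + #(A (d + 1) ∩ B v) = d + 1 := by
      rw [card_sdiff_add_card_inter, cA]
    have hF : A (d + 1) \ B v ⊆ X.powerset := sdiff_subset.trans (hA.subset_powerset _)
    have hle := Phi_le_card_udClo hF
    have hsub : udClo X (A (d + 1) \ B v) ⊆ X.powerset \ (B v \ A (d + 1)) := by
      intro t ht
      refine mem_sdiff.2 ⟨udClo_subset_powerset _ _ ht, fun htBA => ?_⟩
      rw [mem_sdiff] at htBA
      simp only [udClo, upClo, downClo, mem_union, mem_filter, mem_sdiff] at ht
      rcases ht with ⟨-, r, hr, hrt⟩ | ⟨-, r, hr, htr⟩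
      · exact hr.2 (hB.isLowerSet _ hrt htBA.1)
      · exact htBA.2 (hA.isLowerSet _ htr hr.1)
    have c2 := card_le_card hsub
    have c3 := card_sdiff_add_card_eq_card
      ((sdiff_subset (t := A (d + 1))).trans (hB.subset_powerset v))
    rw [hX, card_powerset_groundSet, ← hX] at c3
    have c4 : #(B v \ A (d + 1)) + #(A (d + 1) ∩ B v) = v := by
      rw [inter_comm, card_sdiff_add_card_inter, cB]
    have hm : #(A (d + 1) \ B v) = m := by omega
    rw [hm, ← hX] at hle
    omega

/-- Incomparability of two families is symmetric. -/
lemma Phi_add_le_symm {n s t : ℕ} (hs : s ≤ 2 ^ n) (h : Phi n s + t ≤ 2 ^ n) :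
    Phi n t + s ≤ 2 ^ n := by
  obtain ⟨F, hF, hFs, hPhi⟩ := exists_card_udClo_eq_Phi hs
  set X := groundSet n with hX
  have hN : #X.powerset = 2 ^ n := card_powerset_groundSet n
  have c1 := card_sdiff_add_card_eq_card (udClo_subset_powerset X F)
  obtain ⟨G, hG, hGt⟩ := exists_subset_card_eq (show t ≤ #(X.powerset \ udClo X F) by omega)
  have hle := Phi_le_card_udClo (n := n) (hG.trans sdiff_subset)
  have hsub : udClo X G ⊆ X.powerset \ F := by
    intro r hr
    refine mem_sdiff.2 ⟨udClo_subset_powerset _ _ hr, fun hrF => ?_⟩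
    simp only [udClo, upClo, downClo, mem_union, mem_filter] at hr
    rcases hr with ⟨-, q, hq, hqr⟩ | ⟨-, q, hq, hrq⟩
    · have := mem_sdiff.1 (hG hq)
      exact this.2 (mem_union_right _ (mem_filter.2 ⟨this.1, r, hrF, hqr⟩))
    · have := mem_sdiff.1 (hG hq)
      exact this.2 (mem_union_left _ (mem_filter.2 ⟨this.1, r, hrF, hrq⟩))
  have c2 := card_le_card hsub
  have c3 := card_sdiff_add_card_eq_card hF
  rw [← hX] at hle
  rw [hGt] at hle
  omega

lemma two_pow_lt_Phi_add {n m : ℕ} (hm : m ≤ 2 ^ n) (h : 2 ^ n < 4 * m) :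
    2 ^ n < Phi n m + m := by
  obtain ⟨d, hd, v, hv, h1, h2⟩ := exists_sizes_of_Phi hm
  have k := mul_le_two_pow_mul_crossCount n d v hd hv
  obtain ⟨u, hu⟩ := Nat.exists_eq_add_of_le hv
  by_contra hcon
  have hud : u + d ≤ 2 ^ n := by omega
  have h3 : 2 ^ n * m ≤ u * d := by
    have := Nat.mul_le_mul_left (2 ^ n) h1
    rw [mul_add] at this
    nlinarith
  have h4 : (u + d) * (u + d) ≤ 2 ^ n * 2 ^ n := Nat.mul_le_mul hud hud
  have h5 : 4 * (u * d) ≤ (u + d) * (u + d) := by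
    zify
    nlinarith [sq_nonneg ((u : ℤ) - d)]
  have hpos : 0 < 2 ^ n := by positivity
  nlinarith

lemma Phi_add_two_le {n m : ℕ} (hm : m ≤ 2 ^ n) : Phi (n + 2) m ≤ 2 * Phi n m + m := by
  obtain ⟨d, hd, v, hv, h1, h2⟩ := exists_sizes_of_Phi hm
  have e1 : 2 ^ (n + 1) = 2 * 2 ^ n := by ring
  have e2 : 2 ^ (n + 2) = 4 * 2 ^ n := by ring
  have := Phi_add_le_of_sizes (n := n + 2) (m := m) (d := 2 * d) (v := 2 * v + 2 * 2 ^ n)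
    (by omega) (by omega) (by
      rw [crossCount, min_eq_left (by omega), Nat.sub_eq_zero_of_le (by omega),
        crossCount_zero_left, crossCount_succ_right,
        show (2 * d + 1) / 2 = d by omega, show 2 * d / 2 = d by omega,
        show (2 * v + 2 * 2 ^ n + 1) / 2 = v + 2 ^ n by omega, min_eq_right (by omega),
        crossCount_two_pow_right _ _ hd, Nat.add_sub_cancel]
      omega)
  omega

lemma two_mul_Phi_add_le {n m : ℕ} (hm : m ≤ 2 ^ n) : 2 * Phi n m + m ≤ Phi (n + 2) m := by
  have e1 : 2 ^ (n + 1) = 2 * 2 ^ n := by ring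
  have e2 : 2 ^ (n + 2) = 4 * 2 ^ n := by ring
  obtain ⟨d, hd, v, hv, h1, h2⟩ := exists_sizes_of_Phi (n := n + 2) (m := m) (by omega)
  have k := mul_le_two_pow_mul_crossCount (n + 2) d v hd hv
  have k' : 4 * 2 ^ n * m + d * v ≤ 4 * 2 ^ n * d := by
    have := Nat.mul_le_mul_left (4 * 2 ^ n) h1
    rw [e2] at k
    linarith
  rw [e2] at hd hv h2
  have hpos : 0 < 2 ^ n := by positivity
  rcases le_total d (2 * 2 ^ n) with hd' | hd' <;> rcases le_total v (2 * 2 ^ n) with hv' | hv'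
  · have := Phi_add_le_of_sizes (n := n) (m := m) (d := m) (v := 0) hm (by omega) (by simp)
    have : 2 * m + v ≤ d + 2 * 2 ^ n := by
      obtain ⟨p, hp⟩ := Nat.exists_eq_add_of_le hd'
      obtain ⟨q, hq⟩ := Nat.exists_eq_add_of_le hv'
      have key : 2 * 2 ^ n * (2 * m + v) ≤ 2 * 2 ^ n * (d + 2 * 2 ^ n) := by
        nlinarith [Nat.zero_le (p * q)]
      exact Nat.le_of_mul_le_mul_left key (by positivity)
    omega
  · rw [crossCount, min_eq_left (by omega), Nat.sub_eq_zero_of_le (by omega),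
      crossCount_zero_left, crossCount_succ_right, min_eq_right (by omega),
      crossCount_two_pow_right _ _ (by omega)] at h1
    have := Phi_add_le_of_sizes (n := n) (m := m) (d := d / 2) (v := (v + 1) / 2 - 2 ^ n)
      (by omega) (by omega) (by omega)
    omega
  · have := Phi_add_le_of_sizes (n := n) (m := m) (d := 2 ^ n) (v := 0) le_rfl (by omega)
      (by simpa using hm)
    omega
  · have := Phi_add_le_of_sizes (n := n) (m := m) (d := 2 ^ n) (v := 2 ^ n - m) le_rfl (by omega)
      (by rw [crossCount_two_pow_left _ _ (by omega)]; omega)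
    have : 2 * m + v ≤ d + 2 * 2 ^ n := by
      obtain ⟨p, rfl⟩ := Nat.exists_eq_add_of_le hd'
      obtain ⟨q, rfl⟩ := Nat.exists_eq_add_of_le hv'
      have key : 2 * 2 ^ n * (2 * m + (2 * 2 ^ n + q)) ≤
          2 * 2 ^ n * (2 * 2 ^ n + p + 2 * 2 ^ n) := by
        nlinarith [Nat.zero_le (p * q)]
      exact Nat.le_of_mul_le_mul_left key (by positivity)
    omega

lemma Phi_eq_of_isGreatest {n m s : ℕ} (hm : m ≤ 2 ^ (n + 2)) (hm' : 2 ^ n + 1 ≤ m)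
    (hs : IsGreatest {t : ℕ | t ≤ 2 ^ n ∧ Phi (n + 2) t ≤ 2 ^ (n + 2) - m} s) :
    Phi (n + 2) m = 2 ^ (n + 2) - s := by
  have e2 : 2 ^ (n + 2) = 4 * 2 ^ n := by ring
  obtain ⟨⟨hs1, hs2⟩, hmax⟩ := hs
  have hle := Phi_add_le_symm (n := n + 2) (s := s) (t := m) (by omega) (by omega)
  obtain ⟨t, ht⟩ := Nat.exists_eq_add_of_le (show Phi (n + 2) m ≤ 2 ^ (n + 2) by omega)
  have hsymm := Phi_add_le_symm (t := t) hm (by omega)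
  have k1 := two_pow_lt_Phi_add hm (by omega)
  have ht4 : t ≤ 2 ^ n := by
    by_contra hcon
    have := two_pow_lt_Phi_add (n := n + 2) (m := t) (by omega) (by omega)
    omega
  have := hmax (show t ∈ {t : ℕ | t ≤ 2 ^ n ∧ Phi (n + 2) t ≤ 2 ^ (n + 2) - m} from
    ⟨ht4, by omega⟩)
  omega

/-- Theorem 1 (recursive determination of `Φ`): initial values for `n ∈ {0,1}`, and for
`n ≥ 2`: if `m ≤ 2^(n-2)` then `Φ(n,m) = 2Φ(n-2,m) + m`; if `2^(n-2) + 1 ≤ m ≤ 2^n` then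
`Φ(n,m) = 2^n - s` where `s` is the greatest element of `{0, …, 2^(n-2)}` with
`Φ(n,s) ≤ 2^n - m`. -/
theorem stmt0 :
    (Phi 0 0 = 0 ∧ Phi 0 1 = 1) ∧
    (Phi 1 0 = 0 ∧ Phi 1 1 = 2 ∧ Phi 1 2 = 2) ∧
    ∀ n m : ℕ, 2 ≤ n → m ≤ 2 ^ n →
      (m ≤ 2 ^ (n - 2) → Phi n m = 2 * Phi (n - 2) m + m) ∧
      (2 ^ (n - 2) + 1 ≤ m → ∀ s : ℕ,
        IsGreatest {t : ℕ | t ≤ 2 ^ (n - 2) ∧ Phi n t ≤ 2 ^ n - m} s →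
        Phi n m = 2 ^ n - s) := by
  have zero : ∀ n, Phi n 0 = 0 := fun n => by
    have := Phi_add_le_of_sizes (n := n) (m := 0) (d := 0) (v := 2 ^ n) (Nat.zero_le _) le_rfl (by simp)
    omega
  have lower : ∀ {n m k : ℕ}, m ≤ 2 ^ n → (∀ d ≤ 2 ^ n, ∀ v ≤ 2 ^ n,
      m + crossCount n d v ≤ d → k + m + v ≤ d + 2 ^ n) → k ≤ Phi n m := fun hm h => by
    obtain ⟨d, hd, v, hv, h1, h2⟩ := exists_sizes_of_Phi hm
    have := h d hd v hv h1
    omega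
  refine ⟨⟨zero 0, le_antisymm ?_ ?_⟩, ⟨zero 1, le_antisymm ?_ ?_, le_antisymm ?_ ?_⟩, ?_⟩
  · have := Phi_add_le_of_sizes (n := 0) (m := 1) (d := 1) (v := 0) (by simp) (by simp) (by simp)
    omega
  · exact lower (by norm_num) (by decide)
  · have := Phi_add_le_of_sizes (n := 1) (m := 1) (d := 1) (v := 0) (by simp) (by simp) (by simp)
    omega
  · exact lower (by norm_num) (by decide)
  · have := Phi_add_le_of_sizes (n := 1) (m := 2) (d := 2) (v := 0) (by simp) (by simp) (by simp)
    omega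
  · exact lower (by norm_num) (by decide)
  · intro n m hn hm
    obtain ⟨n, rfl⟩ := Nat.exists_eq_add_of_le' hn
    rw [Nat.add_sub_cancel]
    exact ⟨fun h => le_antisymm (Phi_add_two_le h) (two_mul_Phi_add_le h),
      fun h s hs => Phi_eq_of_isGreatest hm h hs⟩
end

section
/- Let n be a nonnegative integer. There is a chain 𝓕_0 ⊊ 𝓕_1 ⊊ ⋯ ⊊ 𝓕_{2^n} of convex families of subsets of [n] such that |𝓕_m| = m and |(𝓕_m)↕| = Φ(n,m) for each m ∈ {0,…,2^n}. Furthermore, this chain can be chosen so that it includes the families 𝓒_{n,a} and 𝓒*_{n,a} for each a ∈ {0,…,n−2} with a ≡ n (mod 2). -/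
open Finset

/-- A family is convex (w.r.t. ground set `X`) if `𝓕↑ ∩ 𝓕↓ = 𝓕`. -/
def IsConvex (X : Finset ℕ) (F : Finset (Finset ℕ)) : Prop :=
  upClo X F ∩ downClo X F = F

/-- The family `𝒞_{n,a} = {A ⊆ [n] : [(n-a)/2] ⊆ A ⊆ [(n+a)/2]}`. -/
def Cfam (n a : ℕ) : Finset (Finset ℕ) :=
  (groundSet n).powerset.filter
    (fun A => groundSet ((n - a) / 2) ⊆ A ∧ A ⊆ groundSet ((n + a) / 2))

/-- The family `𝒞*_{n,a} = {A ⊆ [n] : A ⊈ {(n-a)/2+1,…,n} and {(n+a)/2+1,…,n} ⊈ A}`. -/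
def CfamStar (n a : ℕ) : Finset (Finset ℕ) :=
  (groundSet n).powerset.filter
    (fun A => ¬ A ⊆ Finset.Icc ((n - a) / 2 + 1) n ∧ ¬ Finset.Icc ((n + a) / 2 + 1) n ⊆ A)

/-! ### The minimal intersection of two up-sets of prescribed sizes -/

/-- The smallest possible size of the intersection of two up-sets of sizes `a` and `b` in the
power set of an `n`-element set. -/
def minInter : ℕ → ℕ → ℕ → ℕ
  | 0, a, b => if a = 0 then 0 else b
  | n + 1, a, b => minInter n (a - 2 ^ n) (b / 2) + minInter n (min a (2 ^ n)) ((b + 1) / 2)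

theorem minInter_zero_left (n b : ℕ) : minInter n 0 b = 0 := by
  induction n generalizing b with
  | zero => simp [minInter]
  | succ n ih => simp [minInter, ih]

theorem minInter_two_pow_left (n b : ℕ) : minInter n (2 ^ n) b = b := by
  induction n generalizing b with
  | zero => simp [minInter]
  | succ n ih =>
    have h1 : 2 ^ (n + 1) - 2 ^ n = 2 ^ n := by rw [pow_succ]; omega
    have h2 : min (2 ^ (n + 1)) (2 ^ n) = 2 ^ n := by rw [pow_succ]; omega
    rw [minInter, h1, h2, ih, ih]
    omega

theorem minInter_succ_of_le {n a : ℕ} (h : a ≤ 2 ^ n) (b : ℕ) :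
    minInter (n + 1) a b = minInter n a ((b + 1) / 2) := by
  rw [minInter, Nat.sub_eq_zero_of_le h, min_eq_left h, minInter_zero_left, zero_add]

theorem minInter_succ_of_ge {n a : ℕ} (h : 2 ^ n ≤ a) (b : ℕ) :
    minInter (n + 1) a b = (b + 1) / 2 + minInter n (a - 2 ^ n) (b / 2) := by
  rw [minInter, min_eq_right h, minInter_two_pow_left, add_comm]

theorem minInter_mono_right (n a : ℕ) : Monotone (minInter n a) := by
  induction n generalizing a with
  | zero => intro b c h; simp only [minInter]; split_ifs <;> omega
  | succ n ih =>
    intro b c h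
    exact add_le_add (ih _ (by omega)) (ih _ (by omega))

theorem minInter_add_le (n a b t : ℕ) : minInter n a (b + t) ≤ minInter n a b + t := by
  induction n generalizing a b t with
  | zero => simp only [minInter]; split_ifs <;> omega
  | succ n ih =>
    have h1 := ih (a - 2 ^ n) (b / 2) ((b + t) / 2 - b / 2)
    have h2 := ih (min a (2 ^ n)) ((b + 1) / 2) ((b + t + 1) / 2 - (b + 1) / 2)
    rw [show b / 2 + ((b + t) / 2 - b / 2) = (b + t) / 2 by omega] at h1
    rw [show (b + 1) / 2 + ((b + t + 1) / 2 - (b + 1) / 2) = (b + t + 1) / 2 by omega] at h2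
    simp only [minInter]
    omega

theorem minInter_le_add_sub (n a b c : ℕ) : minInter n a c ≤ minInter n a b + (c - b) := by
  rcases le_total b c with h | h
  · simpa [Nat.add_sub_cancel' h] using minInter_add_le n a b (c - b)
  · exact (minInter_mono_right n a h).trans (by omega)

/-- The two-point inequality behind the inductive bound for intersections of up-sets. -/
theorem minInter_succ_add_le (n : ℕ) {a₀ a₁ b₀ b₁ : ℕ} (ha : a₀ ≤ a₁) (ha₁ : a₁ ≤ 2 ^ n)
    (hb : b₀ ≤ b₁) :
    minInter (n + 1) (a₀ + a₁) (b₀ + b₁) ≤ minInter n a₀ b₀ + minInter n a₁ b₁ := by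
  induction n generalizing a₀ a₁ b₀ b₁ with
  | zero =>
    have : a₁ ≤ 1 := by simpa using ha₁
    interval_cases a₁ <;> interval_cases a₀ <;> simp [minInter] <;> omega
  | succ n ih =>
    have hN : 2 ^ (n + 1) = 2 * 2 ^ n := by ring
    have ih' : ∀ a a' p, a ≤ 2 ^ n → a' ≤ 2 ^ n →
        minInter (n + 1) (a + a') (p + p) ≤ minInter n a p + minInter n a' p := by
      intro a a' p h h'
      rcases le_total a a' with h'' | h''
      · exact ih h'' h' le_rfl
      · have := ih h'' h (le_refl p)
        rw [add_comm a a', add_comm (minInter n a p)]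
        exact this
    rcases le_total a₁ (2 ^ n) with h₁ | h₁
    · rw [minInter_succ_of_le (by omega : a₀ + a₁ ≤ 2 ^ (n + 1)),
        minInter_succ_of_le (by omega : a₀ ≤ 2 ^ n), minInter_succ_of_le h₁]
      exact (minInter_mono_right _ _ (by omega)).trans
        (ih ha h₁ (by omega : (b₀ + 1) / 2 ≤ (b₁ + 1) / 2))
    rcases le_total (2 ^ n) a₀ with h₀ | h₀
    · rw [minInter_succ_of_ge (by omega : 2 ^ (n + 1) ≤ a₀ + a₁),
        minInter_succ_of_ge h₀, minInter_succ_of_ge h₁]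
      have h2 := ih (by omega : a₀ - 2 ^ n ≤ a₁ - 2 ^ n) (by omega)
        (by omega : b₀ / 2 ≤ b₁ / 2)
      rw [show a₀ - 2 ^ n + (a₁ - 2 ^ n) = a₀ + a₁ - 2 ^ (n + 1) by omega] at h2
      have h3 := minInter_le_add_sub (n + 1) (a₀ + a₁ - 2 ^ (n + 1)) (b₀ / 2 + b₁ / 2)
        ((b₀ + b₁) / 2)
      omega
    · rw [minInter_succ_of_le h₀, minInter_succ_of_ge h₁]
      rcases le_total (a₀ + a₁) (2 ^ (n + 1)) with h | h
      · rw [minInter_succ_of_le h, minInter_succ_of_ge (by omega : 2 ^ n ≤ a₀ + a₁)]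
        set p := ((b₀ + b₁ + 1) / 2) / 2 with hp
        have h2 := ih' a₀ (a₁ - 2 ^ n) p h₀ (by omega)
        rw [minInter_succ_of_le (by omega),
          show a₀ + (a₁ - 2 ^ n) = a₀ + a₁ - 2 ^ n by omega,
          show (p + p + 1) / 2 = p by omega] at h2
        have h3 := minInter_le_add_sub n a₀ ((b₀ + 1) / 2) p
        have h4 := minInter_mono_right n (a₁ - 2 ^ n) (by omega : p ≤ b₁ / 2)
        omega
      · rw [minInter_succ_of_ge h, minInter_succ_of_le (by omega)]
        set p := ((b₀ + b₁) / 2 + 1) / 2 with hp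
        have h2 := ih' a₀ (a₁ - 2 ^ n) p h₀ (by omega)
        rw [minInter_succ_of_ge (by omega),
          show a₀ + (a₁ - 2 ^ n) - 2 ^ n = a₀ + a₁ - 2 ^ (n + 1) by omega,
          show (p + p + 1) / 2 = p by omega, show (p + p) / 2 = p by omega] at h2
        have h3 := minInter_le_add_sub n a₀ ((b₀ + 1) / 2) p
        have h4 := minInter_le_add_sub n (a₁ - 2 ^ n) (b₁ / 2) p
        omega

theorem mul_le_two_pow_mul_minInter (n : ℕ) {a b : ℕ} (ha : a ≤ 2 ^ n) :
    a * b ≤ 2 ^ n * minInter n a b := by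
  induction n generalizing a b with
  | zero =>
    have : a ≤ 1 := by simpa using ha
    interval_cases a <;> simp [minInter]
  | succ n ih =>
    rcases le_total a (2 ^ n) with h | h
    · rw [minInter_succ_of_le h]
      have h1 := ih (b := (b + 1) / 2) h
      have h2 : a * b ≤ a * (2 * ((b + 1) / 2)) := Nat.mul_le_mul_left _ (by omega)
      rw [pow_succ]
      nlinarith
    · rw [minInter_succ_of_ge h]
      have h1 := ih (a := a - 2 ^ n) (b := b / 2) (by rw [pow_succ] at ha; omega)
      obtain ⟨c, rfl⟩ := Nat.exists_eq_add_of_le h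
      rw [Nat.add_sub_cancel_left] at h1 ⊢
      have hc : c ≤ 2 ^ n := by rw [pow_succ] at ha; omega
      rw [pow_succ]
      rcases Nat.even_or_odd' b with ⟨q, rfl | rfl⟩
      · rw [show (2 * q + 1) / 2 = q by omega]
        rw [show 2 * q / 2 = q by omega] at h1 ⊢
        nlinarith
      · rw [show (2 * q + 1 + 1) / 2 = q + 1 by omega]
        rw [show (2 * q + 1) / 2 = q by omega] at h1 ⊢
        nlinarith

theorem minInter_succ_two_pow_add (n : ℕ) {a b : ℕ} (ha : a ≤ 2 ^ (n + 1)) (hb : b ≤ 2 ^ n) :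
    minInter (n + 1) a (2 ^ n + b) = (a + 1) / 2 + minInter n (a / 2) b := by
  induction n generalizing a b with
  | zero =>
    have : a ≤ 2 := by simpa using ha
    have : b ≤ 1 := by simpa using hb
    interval_cases a <;> interval_cases b <;> simp [minInter]
  | succ n ih =>
    have hN : 2 ^ (n + 1) = 2 * 2 ^ n := by ring
    have hN' : 2 ^ (n + 1 + 1) = 2 * 2 ^ (n + 1) := by ring
    rcases le_total a (2 ^ (n + 1)) with h | h
    · rw [minInter_succ_of_le h,
        show (2 ^ (n + 1) + b + 1) / 2 = 2 ^ n + (b + 1) / 2 by omega,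
        ih h (by omega), minInter_succ_of_le (by omega)]
    · rw [minInter_succ_of_ge h, minInter_succ_of_ge (by omega : 2 ^ n ≤ a / 2),
        show (2 ^ (n + 1) + b) / 2 = 2 ^ n + b / 2 by omega, ih (by omega) (by omega),
        show (a - 2 ^ (n + 1)) / 2 = a / 2 - 2 ^ n by omega]
      omega

/-! ### Up-sets in a power set -/

/-- `U` is an up-set in the power set of `X`. -/
def IsUpIn (X : Finset ℕ) (U : Finset (Finset ℕ)) : Prop :=
  U ⊆ X.powerset ∧ ∀ A ∈ U, ∀ B, A ⊆ B → B ⊆ X → B ∈ U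

theorem IsUpIn.nonMemberSubfamily {x : ℕ} {X : Finset ℕ} {U : Finset (Finset ℕ)} (hx : x ∉ X)
    (hU : IsUpIn (insert x X) U) : IsUpIn X (U.nonMemberSubfamily x) := by
  constructor
  · intro A hA
    rw [mem_nonMemberSubfamily] at hA
    exact mem_powerset.2 ((subset_insert_iff_of_notMem hA.2).1 (mem_powerset.1 (hU.1 hA.1)))
  · intro A hA B hAB hB
    rw [mem_nonMemberSubfamily] at hA ⊢
    exact ⟨hU.2 A hA.1 B hAB (hB.trans (subset_insert _ _)), fun h => hx (hB h)⟩

theorem IsUpIn.memberSubfamily {x : ℕ} {X : Finset ℕ} {U : Finset (Finset ℕ)} (hx : x ∉ X)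
    (hU : IsUpIn (insert x X) U) : IsUpIn X (U.memberSubfamily x) := by
  constructor
  · intro A hA
    rw [mem_memberSubfamily] at hA
    exact mem_powerset.2 ((subset_insert_iff_of_notMem hA.2).1
      ((subset_insert _ _).trans (mem_powerset.1 (hU.1 hA.1))))
  · intro A hA B hAB hB
    rw [mem_memberSubfamily] at hA ⊢
    exact ⟨hU.2 _ hA.1 _ (insert_subset_insert _ hAB) (insert_subset_insert _ hB),
      fun h => hx (hB h)⟩

theorem IsUpIn.nonMemberSubfamily_subset {x : ℕ} {X : Finset ℕ} {U : Finset (Finset ℕ)}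
    (hU : IsUpIn (insert x X) U) : U.nonMemberSubfamily x ⊆ U.memberSubfamily x := by
  intro A hA
  rw [mem_nonMemberSubfamily] at hA
  rw [mem_memberSubfamily]
  exact ⟨hU.2 A hA.1 _ (subset_insert _ _)
    (insert_subset (mem_insert_self _ _) (mem_powerset.1 (hU.1 hA.1))), hA.2⟩

theorem card_le_two_pow {X : Finset ℕ} {U : Finset (Finset ℕ)} (hU : U ⊆ X.powerset) :
    U.card ≤ 2 ^ X.card := by
  simpa using card_le_card hU

theorem minInter_card_le (X : Finset ℕ) {U E : Finset (Finset ℕ)} (hU : IsUpIn X U)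
    (hE : IsUpIn X E) : minInter X.card U.card E.card ≤ (U ∩ E).card := by
  induction X using Finset.induction_on generalizing U E with
  | empty =>
    have hU' := hU.1
    have hE' := hE.1
    rw [powerset_empty, subset_singleton_iff] at hU' hE'
    rcases hU' with rfl | rfl <;> rcases hE' with rfl | rfl <;> simp [minInter]
  | insert x X hx ih =>
    rw [card_insert_of_notMem hx, ← card_memberSubfamily_add_card_nonMemberSubfamily x U,
      ← card_memberSubfamily_add_card_nonMemberSubfamily x E,
      ← card_memberSubfamily_add_card_nonMemberSubfamily x (U ∩ E),
      nonMemberSubfamily_inter, memberSubfamily_inter]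
    have h0 := ih (hU.nonMemberSubfamily hx) (hE.nonMemberSubfamily hx)
    have h1 := ih (hU.memberSubfamily hx) (hE.memberSubfamily hx)
    have h2 := minInter_succ_add_le X.card (card_le_card hU.nonMemberSubfamily_subset)
      (card_le_two_pow (hU.memberSubfamily hx).1) (card_le_card hE.nonMemberSubfamily_subset)
    rw [add_comm (card (nonMemberSubfamily x U)), add_comm (card (nonMemberSubfamily x E))] at h2
    omega

/-- The family with prescribed sections `S` (sets avoiding `x`) and `T` (sets containing `x`). -/
def joinSections (x : ℕ) (S T : Finset (Finset ℕ)) : Finset (Finset ℕ) :=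
  S ∪ T.image (insert x)

theorem joinSections_mono (x : ℕ) {S S' T T' : Finset (Finset ℕ)} (hS : S ⊆ S') (hT : T ⊆ T') :
    joinSections x S T ⊆ joinSections x S' T' :=
  union_subset_union hS (image_subset_image hT)

section joinSections

variable {x : ℕ} {X : Finset ℕ} {S T : Finset (Finset ℕ)}

theorem nonMemberSubfamily_joinSections (hx : x ∉ X) (hS : S ⊆ X.powerset) :
    (joinSections x S T).nonMemberSubfamily x = S := by
  rw [joinSections, nonMemberSubfamily_union, nonMemberSubfamily_image_insert, union_empty]
  ext A
  rw [mem_nonMemberSubfamily]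
  exact ⟨fun h => h.1, fun h => ⟨h, fun h' => hx (mem_powerset.1 (hS h) h')⟩⟩

theorem memberSubfamily_joinSections (hx : x ∉ X) (hS : S ⊆ X.powerset) (hT : T ⊆ X.powerset) :
    (joinSections x S T).memberSubfamily x = T := by
  rw [joinSections, memberSubfamily_union,
    memberSubfamily_image_insert fun A hA h => hx (mem_powerset.1 (hT hA) h)]
  convert empty_union T
  rw [eq_empty_iff_forall_notMem]
  intro A hA
  rw [mem_memberSubfamily] at hA
  exact hx (mem_powerset.1 (hS hA.1) (mem_insert_self _ _))

theorem card_joinSections (hx : x ∉ X) (hS : S ⊆ X.powerset) (hT : T ⊆ X.powerset) :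
    (joinSections x S T).card = S.card + T.card := by
  rw [← card_memberSubfamily_add_card_nonMemberSubfamily x,
    nonMemberSubfamily_joinSections hx hS, memberSubfamily_joinSections hx hS hT, add_comm]

theorem card_joinSections_inter {S' T' : Finset (Finset ℕ)} (hx : x ∉ X)
    (hS : S ⊆ X.powerset) (hT : T ⊆ X.powerset) (hS' : S' ⊆ X.powerset) (hT' : T' ⊆ X.powerset) :
    (joinSections x S T ∩ joinSections x S' T').card = (S ∩ S').card + (T ∩ T').card := by
  rw [← card_memberSubfamily_add_card_nonMemberSubfamily x, nonMemberSubfamily_inter,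
    memberSubfamily_inter,
    nonMemberSubfamily_joinSections hx hS, memberSubfamily_joinSections hx hS hT,
    nonMemberSubfamily_joinSections hx hS', memberSubfamily_joinSections hx hS' hT', add_comm]

theorem isUpIn_joinSections (hx : x ∉ X) (hS : IsUpIn X S) (hT : IsUpIn X T) (h : S ⊆ T) :
    IsUpIn (insert x X) (joinSections x S T) := by
  have key : ∀ B, B ⊆ insert x X → B.erase x ⊆ X := fun B hB => by
    rwa [← subset_insert_iff]
  constructor
  · intro A hA
    rw [joinSections, mem_union, mem_image] at hA
    rw [mem_powerset]
    rcases hA with hA | ⟨A, hA, rfl⟩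
    · exact (mem_powerset.1 (hS.1 hA)).trans (subset_insert _ _)
    · exact insert_subset_insert _ (mem_powerset.1 (hT.1 hA))
  · intro A hA B hAB hB
    rw [joinSections, mem_union, mem_image] at hA ⊢
    by_cases hxB : x ∈ B
    · refine Or.inr ⟨B.erase x, ?_, insert_erase hxB⟩
      rcases hA with hA | ⟨A, hA, rfl⟩
      · refine hT.2 A (h hA) _ (fun a ha => mem_erase.2 ⟨?_, hAB ha⟩) (key B hB)
        rintro rfl
        exact hx (mem_powerset.1 (hS.1 hA) ha)
      · refine hT.2 A hA _ (fun a ha => mem_erase.2 ⟨?_, hAB (mem_insert_of_mem ha)⟩) (key B hB)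
        rintro rfl
        exact hx (mem_powerset.1 (hT.1 hA) ha)
    · rcases hA with hA | ⟨A, hA, rfl⟩
      · exact Or.inl (hS.2 A hA B hAB ((subset_insert_iff_of_notMem hxB).1 hB))
      · exact absurd (hAB (mem_insert_self _ _)) hxB

end joinSections

/-- The bound `minInter_card_le` is attained for all sizes, by two chains of up-sets. -/
theorem exists_upIn_card_inter_eq (X : Finset ℕ) :
    ∃ U E : ℕ → Finset (Finset ℕ), Monotone U ∧ Monotone E ∧
      (∀ a, IsUpIn X (U a)) ∧ (∀ b, IsUpIn X (E b)) ∧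
      (∀ a ≤ 2 ^ X.card, (U a).card = a) ∧ (∀ b ≤ 2 ^ X.card, (E b).card = b) ∧
      ∀ a ≤ 2 ^ X.card, ∀ b ≤ 2 ^ X.card, (U a ∩ E b).card = minInter X.card a b := by
  induction X using Finset.induction_on with
  | empty =>
    let V : ℕ → Finset (Finset ℕ) := fun a => if a = 0 then ∅ else {∅}
    have hm : Monotone V := by
      intro a b h
      by_cases ha : a = 0
      · simp [V, ha]
      · simp [V, ha, show b ≠ 0 by omega]
    have hu : ∀ a, IsUpIn ∅ (V a) := by
      intro a
      by_cases ha : a = 0 <;> simp [V, ha, IsUpIn]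
    have hc : ∀ a ≤ 1, (V a).card = a := by
      intro a ha
      interval_cases a <;> simp [V]
    refine ⟨V, V, hm, hm, hu, hu, by simpa using hc, by simpa using hc, ?_⟩
    intro a ha b hb
    have ha : a ≤ 1 := by simpa using ha
    have hb : b ≤ 1 := by simpa using hb
    interval_cases a <;> interval_cases b <;> simp [V, minInter]
  | insert x X hx ih =>
    obtain ⟨U, E, hUm, hEm, hU, hE, hUc, hEc, hUE⟩ := ih
    rw [card_insert_of_notMem hx]
    set N := 2 ^ X.card with hN
    have hN' : 2 ^ (X.card + 1) = 2 * N := by rw [pow_succ, mul_comm]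
    rw [hN']
    have hNU : U N = X.powerset := eq_of_subset_of_card_le (hU N).1
      (by rw [hUc N le_rfl, card_powerset])
    have hle : ∀ a, U (a - N) ⊆ U (min a N) := fun a => by
      rcases le_total a N with h | h
      · exact hUm (by omega)
      · rw [min_eq_right h, hNU]
        exact (hU _).1
    refine ⟨fun a => joinSections x (U (a - N)) (U (min a N)),
      fun b => joinSections x (E (b / 2)) (E ((b + 1) / 2)), ?_, ?_, ?_, ?_, ?_, ?_, ?_⟩
    · intro a b h
      exact joinSections_mono x (hUm (by omega)) (hUm (by omega))
    · intro a b h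
      exact joinSections_mono x (hEm (by omega)) (hEm (by omega))
    · exact fun a => isUpIn_joinSections hx (hU _) (hU _) (hle a)
    · exact fun b => isUpIn_joinSections hx (hE _) (hE _) (hEm (by omega))
    · intro a ha
      dsimp only
      rw [card_joinSections hx (hU _).1 (hU _).1, hUc _ (by omega), hUc _ (by omega)]
      omega
    · intro b hb
      dsimp only
      rw [card_joinSections hx (hE _).1 (hE _).1, hEc _ (by omega), hEc _ (by omega)]
      omega
    · intro a ha b hb
      dsimp only
      rw [card_joinSections_inter hx (hU _).1 (hU _).1 (hE _).1 (hE _).1,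
        hUE _ (by omega) _ (by omega), hUE _ (by omega) _ (by omega), minInter]

/-! ### Cross-incomparable pairs of families -/

/-- No member of `F` is comparable to a member of `G`; both are families of subsets of `X`. -/
def CrossIncomparable (X : Finset ℕ) (F G : Finset (Finset ℕ)) : Prop :=
  F ⊆ X.powerset ∧ G ⊆ X.powerset ∧ ∀ A ∈ F, ∀ B ∈ G, ¬ A ⊆ B ∧ ¬ B ⊆ A

theorem CrossIncomparable.symm {X : Finset ℕ} {F G : Finset (Finset ℕ)}
    (h : CrossIncomparable X F G) : CrossIncomparable X G F :=
  ⟨h.2.1, h.1, fun A hA B hB => (h.2.2 B hB A hA).symm⟩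

theorem CrossIncomparable.mono_left {X : Finset ℕ} {F F' G : Finset (Finset ℕ)}
    (h : CrossIncomparable X F G) (hF : F' ⊆ F) : CrossIncomparable X F' G :=
  ⟨hF.trans h.1, h.2.1, fun A hA B hB => h.2.2 A (hF hA) B hB⟩

theorem isUpIn_upClo (X : Finset ℕ) (F : Finset (Finset ℕ)) : IsUpIn X (upClo X F) := by
  refine ⟨filter_subset _ _, fun A hA B hAB hB => ?_⟩
  simp only [upClo, mem_filter, mem_powerset] at hA ⊢
  obtain ⟨-, C, hC, hCA⟩ := hA
  exact ⟨hB, C, hC, hCA.trans hAB⟩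

theorem isUpIn_compl_downClo (X : Finset ℕ) (F : Finset (Finset ℕ)) :
    IsUpIn X (X.powerset \ downClo X F) := by
  refine ⟨sdiff_subset, fun A hA B hAB hB => ?_⟩
  simp only [downClo, mem_sdiff, mem_filter, mem_powerset, not_and, not_exists] at hA ⊢
  exact ⟨hB, fun _ C hC hBC => hA.2 hA.1 C hC (hAB.trans hBC)⟩

theorem crossIncomparable_sdiff {X : Finset ℕ} {U E : Finset (Finset ℕ)} (hU : IsUpIn X U)
    (hE : IsUpIn X E) : CrossIncomparable X (U \ E) (E \ U) := by
  refine ⟨sdiff_subset.trans hU.1, sdiff_subset.trans hE.1, fun A hA B hB => ⟨fun h => ?_,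
    fun h => ?_⟩⟩ <;> rw [mem_sdiff] at hA hB
  · exact hB.2 (hU.2 A hA.1 B h (mem_powerset.1 (hE.1 hB.1)))
  · exact hA.2 (hE.2 B hB.1 A h (mem_powerset.1 (hU.1 hA.1)))

theorem CrossIncomparable.exists_isUpIn {X : Finset ℕ} {F G : Finset (Finset ℕ)}
    (h : CrossIncomparable X F G) :
    ∃ U E, IsUpIn X U ∧ IsUpIn X E ∧ F ⊆ U \ E ∧ G ⊆ E \ U := by
  obtain ⟨hF, hG, h⟩ := h
  refine ⟨_, _, isUpIn_upClo X F, isUpIn_compl_downClo X F, fun A hA => ?_, fun B hB => ?_⟩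
  · simp only [upClo, downClo, mem_sdiff, mem_filter, not_and]
    exact ⟨⟨hF hA, A, hA, Subset.rfl⟩, fun _ hn => hn (hF hA) ⟨A, hA, Subset.rfl⟩⟩
  · simp only [upClo, downClo, mem_sdiff, mem_filter, not_and, not_exists]
    exact ⟨⟨hG hB, fun _ A hA => (h A hA B hB).2⟩, fun _ A hA => (h A hA B hB).1⟩

/-- A cross-incomparable pair over a set with two more elements than `X` whose first member is
small yields a cross-incomparable pair over `X` whose members are not too small. -/
theorem CrossIncomparable.exists_of_card_eq_add_two {X X' : Finset ℕ} {F G : Finset (Finset ℕ)}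
    (hX : X'.card = X.card + 2) (h : CrossIncomparable X' F G) (hF : F.card ≤ 2 ^ X.card) :
    ∃ F' G', CrossIncomparable X F' G' ∧ F.card ≤ F'.card ∧
      G.card + F.card ≤ 2 * 2 ^ X.card + 2 * G'.card := by
  obtain ⟨U, E, hU, hE, hFU, hGE⟩ := h.exists_isUpIn
  obtain ⟨V, W, -, -, hV, hW, hVc, hWc, hVW⟩ := exists_upIn_card_inter_eq X
  set k := X.card with hk
  set M := 2 ^ k with hM
  have hN : 2 ^ (k + 1) = 2 * M := by rw [hM]; ring
  have hP : 2 ^ (k + 2) = 4 * M := by rw [hM]; ring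
  have hF' := card_le_card hFU
  have hG' := card_le_card hGE
  have hx := card_sdiff_add_card_inter U E
  have hy := card_sdiff_add_card_inter E U
  rw [inter_comm] at hy
  have hz := minInter_card_le X' hU hE
  have ha := card_le_two_pow hU.1
  have hb := card_le_two_pow hE.1
  rw [hX] at hz ha hb
  have hHarris := (mul_le_two_pow_mul_minInter (k + 2) (b := E.card) ha).trans
    (Nat.mul_le_mul_left _ hz)
  rw [hP] at ha hb hHarris
  by_cases hcase : U.card ≤ 2 * M ∧ 2 * M ≤ E.card
  · obtain ⟨h1, h2⟩ := hcase
    have hj := minInter_succ_of_le (n := k + 1) (by omega : U.card ≤ 2 ^ (k + 1)) E.card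
    obtain ⟨b, hb'⟩ := Nat.exists_eq_add_of_le (by omega : M ≤ (E.card + 1) / 2)
    rw [hb', minInter_succ_two_pow_add k (by omega) (by omega)] at hj
    change minInter (k + 2) _ _ = _ at hj
    have hI := hVW (U.card / 2) (by omega) b (by omega)
    have hV' := hVc (U.card / 2) (by omega)
    have hW' := hWc b (by omega)
    have hx' := card_sdiff_add_card_inter (V (U.card / 2)) (W b)
    have hy' := card_sdiff_add_card_inter (W b) (V (U.card / 2))
    rw [inter_comm] at hy'
    exact ⟨_, _, crossIncomparable_sdiff (hV (U.card / 2)) (hW b), by omega, by omega⟩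
  · obtain ⟨F', hF'X, hF'c⟩ := exists_subset_card_eq (s := X.powerset) (n := F.card)
      (by rwa [card_powerset])
    refine ⟨F', ∅, ⟨hF'X, empty_subset _, by simp⟩, hF'c.ge, ?_⟩
    rw [card_empty]
    have hMpos : 0 < M := by positivity
    rcases le_total U.card (2 * M) with h1 | h1
    · have h2 : E.card ≤ 2 * M := by by_contra h2; exact hcase ⟨h1, by omega⟩
      obtain ⟨c, hc⟩ := Nat.exists_eq_add_of_le h1
      obtain ⟨d, hd⟩ := Nat.exists_eq_add_of_le h2
      by_contra hlt
      nlinarith [Nat.zero_le (c * d)]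
    · rcases le_total (2 * M) E.card with h2 | h2
      · obtain ⟨c, hc⟩ := Nat.exists_eq_add_of_le h1
        obtain ⟨d, hd⟩ := Nat.exists_eq_add_of_le h2
        rw [hc, hd] at hHarris
        by_contra hlt
        nlinarith [Nat.zero_le (c * d)]
      · have h3 : 2 * M * E.card ≤ 2 * M * (2 * (U ∩ E).card) := by nlinarith
        have h4 := Nat.le_of_mul_le_mul_left h3 (by omega)
        omega

/-- The sets incomparable to every member of `F`. -/
def incomparables (X : Finset ℕ) (F : Finset (Finset ℕ)) : Finset (Finset ℕ) :=
  X.powerset \ udClo X F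

theorem mem_incomparables {X : Finset ℕ} {F : Finset (Finset ℕ)} {B : Finset ℕ} :
    B ∈ incomparables X F ↔ B ⊆ X ∧ ∀ A ∈ F, ¬ A ⊆ B ∧ ¬ B ⊆ A := by
  simp only [incomparables, udClo, upClo, downClo, mem_sdiff, mem_union, mem_filter, mem_powerset,
    not_or, not_and, not_exists]
  constructor
  · rintro ⟨h, h1, h2⟩
    exact ⟨h, fun A hA => ⟨h1 h A hA, h2 h A hA⟩⟩
  · rintro ⟨h, h1⟩
    exact ⟨h, fun _ A hA => (h1 A hA).1, fun _ A hA => (h1 A hA).2⟩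

theorem incomparables_subset (X : Finset ℕ) (F : Finset (Finset ℕ)) :
    incomparables X F ⊆ X.powerset := sdiff_subset

theorem incomparables_anti {X : Finset ℕ} {F F' : Finset (Finset ℕ)} (h : F ⊆ F') :
    incomparables X F' ⊆ incomparables X F := by
  intro B hB
  rw [mem_incomparables] at hB ⊢
  exact ⟨hB.1, fun A hA => hB.2 A (h hA)⟩

theorem crossIncomparable_incomparables {X : Finset ℕ} {F : Finset (Finset ℕ)}
    (hF : F ⊆ X.powerset) : CrossIncomparable X F (incomparables X F) :=
  ⟨hF, incomparables_subset X F, fun _ hA _ hB => (mem_incomparables.1 hB).2 _ hA⟩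

theorem card_udClo_add_card_incomparables (X : Finset ℕ) (F : Finset (Finset ℕ)) :
    (udClo X F).card + (incomparables X F).card = 2 ^ X.card := by
  rw [incomparables, ← card_powerset, add_comm]
  exact card_sdiff_add_card_eq_card (union_subset (filter_subset _ _) (filter_subset _ _))

/-- `F` has the most incomparable sets among all families of subsets of `X` at least as large. -/
def IsOptimal (X : Finset ℕ) (F : Finset (Finset ℕ)) : Prop :=
  ∀ F' G', CrossIncomparable X F' G' → F.card ≤ F'.card → G'.card ≤ (incomparables X F).card

theorem IsOptimal.card_udClo_eq {n : ℕ} {F : Finset (Finset ℕ)} (h : IsOptimal (groundSet n) F)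
    (hF : F ⊆ (groundSet n).powerset) : (udClo (groundSet n) F).card = Phi n F.card := by
  apply le_antisymm
  · refine le_csInf ⟨_, F, hF, rfl, rfl⟩ ?_
    rintro k ⟨F', hF', hc, rfl⟩
    have h1 := h F' _ (crossIncomparable_incomparables hF') hc.ge
    have h2 := card_udClo_add_card_incomparables (groundSet n) F
    have h3 := card_udClo_add_card_incomparables (groundSet n) F'
    omega
  · exact Nat.sInf_le ⟨F, hF, rfl, rfl⟩

/-! ### Convex families -/

theorem isConvex_iff {X : Finset ℕ} {F : Finset (Finset ℕ)} :
    IsConvex X F ↔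
      F ⊆ X.powerset ∧ ∀ A ∈ F, ∀ C ∈ F, ∀ B, A ⊆ B → B ⊆ C → B ∈ F := by
  constructor
  · intro h
    have hF : F ⊆ X.powerset := by
      rw [← h]
      exact inter_subset_left.trans (filter_subset _ _)
    refine ⟨hF, fun A hA C hC B hAB hBC => ?_⟩
    rw [← h]
    have hB : B ∈ X.powerset := mem_powerset.2 (hBC.trans (mem_powerset.1 (hF hC)))
    exact mem_inter.2 ⟨mem_filter.2 ⟨hB, A, hA, hAB⟩, mem_filter.2 ⟨hB, C, hC, hBC⟩⟩
  · rintro ⟨hF, h⟩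
    ext B
    simp only [upClo, downClo, mem_inter, mem_filter]
    constructor
    · rintro ⟨⟨-, A, hA, hAB⟩, -, C, hC, hBC⟩
      exact h A hA C hC B hAB hBC
    · exact fun hB => ⟨⟨hF hB, B, hB, Subset.rfl⟩, hF hB, B, hB, Subset.rfl⟩

theorem IsConvex.subset {X : Finset ℕ} {F : Finset (Finset ℕ)} (h : IsConvex X F) :
    F ⊆ X.powerset := (isConvex_iff.1 h).1

theorem isConvex_empty (X : Finset ℕ) : IsConvex X ∅ :=
  isConvex_iff.2 ⟨empty_subset _, by simp⟩

theorem isConvex_powerset (X : Finset ℕ) : IsConvex X X.powerset :=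
  isConvex_iff.2 ⟨Subset.rfl, fun _ _ _ hC _ _ hBC =>
    mem_powerset.2 (hBC.trans (mem_powerset.1 hC))⟩

theorem IsConvex.card_upClo_add_card_downClo {X : Finset ℕ} {F : Finset (Finset ℕ)}
    (h : IsConvex X F) :
    (upClo X F).card + (downClo X F).card = (udClo X F).card + F.card := by
  rw [udClo, ← card_union_add_card_inter, show upClo X F ∩ downClo X F = F from h]

theorem IsConvex.exists_insert {X : Finset ℕ} {F G : Finset (Finset ℕ)} (hF : IsConvex X F)
    (hG : IsConvex X G) (hFG : F ⊂ G) : ∃ S ∈ G, S ∉ F ∧ IsConvex X (insert S F) := by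
  rw [isConvex_iff] at hF hG
  suffices h : ∃ S ∈ G, S ∉ F ∧ (∀ A ∈ F, ∀ B, A ⊆ B → B ⊆ S → B ∈ insert S F) ∧
      ∀ C ∈ F, ∀ B, S ⊆ B → B ⊆ C → B ∈ insert S F by
    obtain ⟨S, hSG, hSF, hlow, hupp⟩ := h
    refine ⟨S, hSG, hSF, isConvex_iff.2 ⟨insert_subset (hG.1 hSG) hF.1, ?_⟩⟩
    intro A hA C hC B hAB hBC
    rcases mem_insert.1 hA with rfl | hAF <;> rcases mem_insert.1 hC with rfl | hCF
    · rw [hBC.antisymm hAB]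
      exact mem_insert_self _ _
    · exact hupp C hCF B hAB hBC
    · exact hlow A hAF B hAB hBC
    · exact mem_insert_of_mem (hF.2 A hAF C hCF B hAB hBC)
  by_cases h1 : ((G \ F).filter fun S => ∃ A ∈ F, A ⊆ S).Nonempty
  · obtain ⟨S, hS, hmin⟩ := exists_min_image _ card h1
    simp only [mem_filter, mem_sdiff] at hS hmin
    obtain ⟨⟨hSG, hSF⟩, D, hD, hDS⟩ := hS
    refine ⟨S, hSG, hSF, fun A hA B hAB hBS => ?_, fun C hC B hSB hBC => ?_⟩
    · by_cases hB : B ∈ F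
      · exact mem_insert_of_mem hB
      · have := hmin B ⟨⟨hG.2 A (hFG.1 hA) S hSG B hAB hBS, hB⟩, A, hA, hAB⟩
        rw [eq_of_subset_of_card_le hBS this]
        exact mem_insert_self _ _
    · exact absurd (hF.2 D hD C hC S hDS (hSB.trans hBC)) hSF
  by_cases h2 : ((G \ F).filter fun S => ∃ C ∈ F, S ⊆ C).Nonempty
  · obtain ⟨S, hS, hmax⟩ := exists_max_image _ card h2
    simp only [mem_filter, mem_sdiff] at hS hmax
    obtain ⟨⟨hSG, hSF⟩, D, hD, hSD⟩ := hS
    refine ⟨S, hSG, hSF, fun A hA B hAB hBS => ?_, fun C hC B hSB hBC => ?_⟩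
    · exact absurd (hF.2 A hA D hD S (hAB.trans hBS) hSD) hSF
    · by_cases hB : B ∈ F
      · exact mem_insert_of_mem hB
      · have := hmax B ⟨⟨hG.2 S hSG C (hFG.1 hC) B hSB hBC, hB⟩, C, hC, hBC⟩
        rw [← eq_of_subset_of_card_le hSB this]
        exact mem_insert_self _ _
  · rw [not_nonempty_iff_eq_empty, filter_eq_empty_iff] at h1 h2
    obtain ⟨S, hSG, hSF⟩ := exists_of_ssubset hFG
    have hS := mem_sdiff.2 ⟨hSG, hSF⟩
    exact ⟨S, hSG, hSF, fun A hA B hAB hBS => absurd ⟨A, hA, hAB.trans hBS⟩ (h1 hS),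
      fun C hC B hSB hBC => absurd ⟨C, hC, hSB.trans hBC⟩ (h2 hS)⟩

theorem IsConvex.image_insert {x : ℕ} {X X' : Finset ℕ} {F : Finset (Finset ℕ)} (hx : x ∉ X)
    (hX : insert x X ⊆ X') (hF : IsConvex X F) : IsConvex X' (F.image (insert x)) := by
  rw [isConvex_iff] at hF ⊢
  constructor
  · intro B hB
    obtain ⟨A, hA, rfl⟩ := mem_image.1 hB
    exact mem_powerset.2 ((insert_subset_insert _ (mem_powerset.1 (hF.1 hA))).trans hX)
  · intro A' hA' C' hC' B hAB hBC
    obtain ⟨A, hA, rfl⟩ := mem_image.1 hA'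
    obtain ⟨C, hC, rfl⟩ := mem_image.1 hC'
    have hxB : x ∈ B := hAB (mem_insert_self _ _)
    have hxA : x ∉ A := fun h => hx (mem_powerset.1 (hF.1 hA) h)
    refine mem_image.2 ⟨B.erase x, hF.2 A hA C hC _ ?_ ?_, insert_erase hxB⟩
    · exact fun a ha => mem_erase.2 ⟨fun h => hxA (h ▸ ha), hAB (mem_insert_of_mem ha)⟩
    · exact subset_insert_iff.1 hBC

theorem isConvex_incomparables (X : Finset ℕ) (F : Finset (Finset ℕ)) :
    IsConvex X (incomparables X F) := by
  refine isConvex_iff.2 ⟨incomparables_subset X F, fun P hP Q hQ T hPT hTQ => ?_⟩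
  rw [mem_incomparables] at hP hQ ⊢
  exact ⟨hTQ.trans hQ.1, fun A hA => ⟨fun h => (hQ.2 A hA).1 (h.trans hTQ),
    fun h => (hP.2 A hA).2 (hPT.trans h)⟩⟩

/-! ### Complements of incomparable sets -/

/-- The complements in `X` of the sets incomparable to every member of `F`. -/
def coIncomparables (X : Finset ℕ) (F : Finset (Finset ℕ)) : Finset (Finset ℕ) :=
  X.powerset.filter fun A => X \ A ∈ incomparables X F

theorem mem_coIncomparables {X : Finset ℕ} {F : Finset (Finset ℕ)} {B : Finset ℕ} :
    B ∈ coIncomparables X F ↔ B ⊆ X ∧ ∀ A ∈ F, ¬ A ⊆ X \ B ∧ ¬ X \ B ⊆ A := by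
  rw [coIncomparables, mem_filter, mem_powerset, mem_incomparables]
  exact and_congr_right fun _ => and_iff_right sdiff_subset

theorem coIncomparables_anti {X : Finset ℕ} {F F' : Finset (Finset ℕ)} (h : F ⊆ F') :
    coIncomparables X F' ⊆ coIncomparables X F :=
  monotone_filter_right _ fun _ _ hA => incomparables_anti h hA

theorem isConvex_coIncomparables (X : Finset ℕ) (F : Finset (Finset ℕ)) :
    IsConvex X (coIncomparables X F) := by
  refine isConvex_iff.2 ⟨filter_subset _ _, fun P hP Q hQ T hPT hTQ => ?_⟩
  rw [coIncomparables, mem_filter, mem_powerset] at hP hQ ⊢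
  exact ⟨hTQ.trans hQ.1, (isConvex_iff.1 (isConvex_incomparables X F)).2 _ hQ.2 _ hP.2 _
    (sdiff_subset_sdiff Subset.rfl hTQ) (sdiff_subset_sdiff Subset.rfl hPT)⟩

theorem card_coIncomparables (X : Finset ℕ) (F : Finset (Finset ℕ)) :
    (coIncomparables X F).card = (incomparables X F).card := by
  refine card_nbij' (X \ ·) (X \ ·) ?_ ?_ ?_ ?_
  · exact fun A hA => (mem_filter.1 hA).2
  · intro A hA
    have hA' : A ⊆ X := mem_powerset.1 (incomparables_subset X F hA)
    refine mem_filter.2 ⟨mem_powerset.2 sdiff_subset, ?_⟩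
    rwa [Finset.sdiff_sdiff_eq_self hA']
  · exact fun A hA => Finset.sdiff_sdiff_eq_self (mem_powerset.1 (mem_filter.1 hA).1)
  · exact fun A hA => Finset.sdiff_sdiff_eq_self (mem_powerset.1 (incomparables_subset X F hA))

theorem card_le_card_incomparables_coIncomparables {X : Finset ℕ} {F : Finset (Finset ℕ)}
    (hF : F ⊆ X.powerset) : F.card ≤ (incomparables X (coIncomparables X F)).card := by
  refine card_le_card_of_injOn (X \ ·) ?_ ?_
  · intro A hA
    have hAX := mem_powerset.1 (hF hA)
    refine mem_incomparables.2 ⟨sdiff_subset, fun B hB => ?_⟩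
    obtain ⟨hBX, hB⟩ := mem_coIncomparables.1 hB
    refine ⟨fun h => (hB A hA).1 ?_, fun h => (hB A hA).2 ?_⟩
    · have := sdiff_subset_sdiff (Subset.refl X) h
      rwa [Finset.sdiff_sdiff_eq_self hAX] at this
    · have := sdiff_subset_sdiff (Subset.refl X) h
      rwa [Finset.sdiff_sdiff_eq_self hAX] at this
  · intro A hA B hB h
    rw [← Finset.sdiff_sdiff_eq_self (mem_powerset.1 (hF hA)),
      ← Finset.sdiff_sdiff_eq_self (mem_powerset.1 (hF hB))]
    exact congrArg (X \ ·) h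

theorem coIncomparables_empty (X : Finset ℕ) : coIncomparables X ∅ = X.powerset := by
  ext B
  simp [mem_coIncomparables]

theorem coIncomparables_image_insert_powerset {x y : ℕ} {X : Finset ℕ} (hx : x ∉ insert y X)
    (hy : y ∉ X) :
    coIncomparables (insert x (insert y X)) (X.powerset.image (insert x)) =
      X.powerset.image (insert x) := by
  ext B
  rw [mem_coIncomparables, mem_image]
  constructor
  · rintro ⟨hB, h⟩
    have h1 := (h _ (mem_image_of_mem _ (empty_mem_powerset X))).1
    have h2 := (h _ (mem_image_of_mem _ (mem_powerset_self X))).2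
    have hxB : x ∈ B := by
      by_contra hxB
      exact h1 (by simp [hxB])
    have hyB : y ∉ B := by
      intro hyB
      refine h2 fun a ha => ?_
      simp only [mem_sdiff, mem_insert] at ha ⊢
      rcases ha with ⟨rfl | rfl | ha, haB⟩
      · exact Or.inl rfl
      · exact absurd hyB haB
      · exact Or.inr ha
    refine ⟨B.erase x, mem_powerset.2 fun a ha => ?_, insert_erase hxB⟩
    rw [mem_erase] at ha
    have := hB ha.2
    simp only [mem_insert] at this
    rcases this with rfl | rfl | h
    · exact absurd rfl ha.1
    · exact absurd ha.2 hyB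
    · exact h
  · rintro ⟨C, hC, rfl⟩
    rw [mem_powerset] at hC
    refine ⟨insert_subset_insert _ (hC.trans (subset_insert _ _)), fun A' hA' => ?_⟩
    obtain ⟨A, hA, rfl⟩ := mem_image.1 hA'
    rw [mem_powerset] at hA
    refine ⟨fun h => ?_, fun h => ?_⟩
    · exact (mem_sdiff.1 (h (mem_insert_self _ _))).2 (mem_insert_self _ _)
    · have hxy : y ≠ x := fun h => hx (h ▸ mem_insert_self _ _)
      have hyC : y ∉ insert x C := by simpa [hxy] using fun h => hy (hC h)
      have hyA : y ∉ insert x A := by simpa [hxy] using fun h => hy (hA h)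
      exact hyA (h (mem_sdiff.2 ⟨mem_insert_of_mem (mem_insert_self _ _), hyC⟩))

theorem IsConvex.card_incomparables_image_insert {x y : ℕ} {X : Finset ℕ}
    {F : Finset (Finset ℕ)} (hx : x ∉ insert y X) (hy : y ∉ X) (hF : IsConvex X F) :
    2 * 2 ^ X.card + 2 * (incomparables X F).card ≤
      (incomparables (insert x (insert y X)) (F.image (insert x))).card + F.card := by
  have hxX : x ∉ X := fun h => hx (mem_insert_of_mem h)
  have hxy : x ≠ y := fun h => hx (h ▸ mem_insert_self _ _)
  have hFx : ∀ A ∈ F, x ∉ A := fun A hA h => hxX (mem_powerset.1 (hF.subset hA) h)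
  have hFy : ∀ A ∈ F, y ∉ A := fun A hA h => hy (mem_powerset.1 (hF.subset hA) h)
  set I := incomparables (insert x (insert y X)) (F.image (insert x)) with hI
  have hmem : ∀ B, B ∈ I ↔ B ⊆ insert x (insert y X) ∧
      ∀ A ∈ F, ¬ insert x A ⊆ B ∧ ¬ B ⊆ insert x A := fun B => by
    rw [hI, mem_incomparables, forall_mem_image]
  have e0 := card_memberSubfamily_add_card_nonMemberSubfamily x I
  have e1 := card_memberSubfamily_add_card_nonMemberSubfamily y (I.memberSubfamily x)
  have e2 := card_memberSubfamily_add_card_nonMemberSubfamily y (I.nonMemberSubfamily x)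
  have c1 : (X.powerset \ upClo X F).card ≤ ((I.memberSubfamily x).memberSubfamily y).card := by
    refine card_le_card fun C hC => ?_
    simp only [upClo, mem_sdiff, mem_filter, mem_powerset, not_and, not_exists] at hC
    obtain ⟨hC, h⟩ := hC
    have hxC : x ∉ C := fun h => hxX (hC h)
    have hyC : y ∉ C := fun h => hy (hC h)
    simp only [mem_memberSubfamily, hmem, mem_insert, hxy, hxC, hyC, not_false_eq_true, and_true,
      or_false]
    refine ⟨insert_subset_insert _ (insert_subset_insert _ hC), fun A hA => ⟨fun h' => ?_,
      fun h' => ?_⟩⟩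
    · refine h hC A hA fun a ha => ?_
      have := h' (mem_insert_of_mem ha)
      simp only [mem_insert] at this
      rcases this with rfl | rfl | this
      · exact absurd ha (hFx A hA)
      · exact absurd ha (hFy A hA)
      · exact this
    · have := h' (mem_insert_of_mem (mem_insert_self y C))
      exact hFy A hA ((mem_insert.1 this).resolve_left hxy.symm)
  have c2 : (incomparables X F).card ≤ ((I.memberSubfamily x).nonMemberSubfamily y).card := by
    refine card_le_card fun C hC => ?_
    obtain ⟨hC, h⟩ := mem_incomparables.1 hC
    have hxC : x ∉ C := fun h => hxX (hC h)
    have hyC : y ∉ C := fun h => hy (hC h)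
    simp only [mem_memberSubfamily, mem_nonMemberSubfamily, hmem, hxC, hyC, not_false_eq_true,
      and_true]
    refine ⟨insert_subset_insert _ (hC.trans (subset_insert _ _)), fun A hA => ⟨fun h' => ?_,
      fun h' => ?_⟩⟩
    · exact (h A hA).1 ((insert_subset_insert_iff (hFx A hA)).1 h')
    · exact (h A hA).2 ((insert_subset_insert_iff hxC).1 h')
  have c3 : X.powerset.card ≤ ((I.nonMemberSubfamily x).memberSubfamily y).card := by
    refine card_le_card fun C hC => ?_
    rw [mem_powerset] at hC
    have hxC : x ∉ C := fun h => hxX (hC h)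
    have hyC : y ∉ C := fun h => hy (hC h)
    simp only [mem_memberSubfamily, mem_nonMemberSubfamily, hmem, mem_insert, hxy, hxC, hyC,
      not_false_eq_true, and_true, or_false]
    refine ⟨(insert_subset_insert _ hC).trans (subset_insert _ _), fun A hA => ⟨fun h' => ?_,
      fun h' => ?_⟩⟩
    · exact hxC ((mem_insert.1 (h' (mem_insert_self x A))).resolve_left hxy)
    · exact hFy A hA ((mem_insert.1 (h' (mem_insert_self y C))).resolve_left hxy.symm)
  have c4 : (X.powerset \ downClo X F).card ≤
      ((I.nonMemberSubfamily x).nonMemberSubfamily y).card := by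
    refine card_le_card fun C hC => ?_
    simp only [downClo, mem_sdiff, mem_filter, mem_powerset, not_and, not_exists] at hC
    obtain ⟨hC, h⟩ := hC
    have hxC : x ∉ C := fun h => hxX (hC h)
    have hyC : y ∉ C := fun h => hy (hC h)
    simp only [mem_nonMemberSubfamily, hmem, hxC, hyC, not_false_eq_true, and_true]
    refine ⟨hC.trans ((subset_insert _ _).trans (subset_insert _ _)), fun A hA => ⟨fun h' => ?_,
      fun h' => ?_⟩⟩
    · exact hxC (h' (mem_insert_self x A))
    · exact h hC A hA ((subset_insert_iff_of_notMem hxC).1 h')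
  have h1 := card_sdiff_add_card_eq_card (s := upClo X F) (filter_subset _ X.powerset)
  have h2 := card_sdiff_add_card_eq_card (s := downClo X F) (filter_subset _ X.powerset)
  have h3 := hF.card_upClo_add_card_downClo
  have h4 := card_udClo_add_card_incomparables X F
  rw [card_powerset] at h1 h2 c3
  omega

/-! ### Chains of optimal convex families -/

/-- `F 0 ⊆ F 1 ⊆ ⋯ ⊆ F N` are convex optimal families with `F m` of size `m`. -/
def IsOptimalChain (X : Finset ℕ) (N : ℕ) (F : ℕ → Finset (Finset ℕ)) : Prop :=
  (∀ m ≤ N, IsConvex X (F m) ∧ (F m).card = m ∧ IsOptimal X (F m)) ∧ ∀ m < N, F m ⊆ F (m + 1)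

theorem IsOptimalChain.exists_extend {X : Finset ℕ} {N : ℕ} {F : ℕ → Finset (Finset ℕ)}
    (hF : IsOptimalChain X N F) {B : Finset (Finset ℕ)} (hB : IsConvex X B) (hFB : F N ⊆ B)
    (hopt : ∀ A, F N ⊂ A → A ⊆ B → IsOptimal X A) :
    ∃ K, IsOptimalChain X B.card K ∧ (∀ m ≤ N, K m = F m) ∧ K B.card = B := by
  obtain ⟨d, hd⟩ := Nat.exists_eq_add_of_le (card_le_card hFB)
  rw [(hF.1 N le_rfl).2.1] at hd
  induction d generalizing N F with
  | zero =>
    have hN : F N = B := eq_of_subset_of_card_le hFB (by rw [(hF.1 N le_rfl).2.1]; omega)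
    rw [add_zero] at hd
    exact ⟨F, by rwa [hd], fun _ _ => rfl, by rw [hd, hN]⟩
  | succ d ih =>
    obtain ⟨hconv, hcard, -⟩ := hF.1 N le_rfl
    have hss : F N ⊂ B := hFB.ssubset_of_ne fun h => by rw [← h] at hd; omega
    obtain ⟨S, hSB, hSF, hS⟩ := hconv.exists_insert hB hss
    have hsub : insert S (F N) ⊆ B := insert_subset hSB hFB
    set F' : ℕ → Finset (Finset ℕ) := Function.update F (N + 1) (insert S (F N)) with hF'
    have hF'N : F' (N + 1) = insert S (F N) := Function.update_self ..
    have hF'm : ∀ m ≤ N, F' m = F m := fun m hm =>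
      Function.update_of_ne (by omega) ..
    have hchain : IsOptimalChain X (N + 1) F' := by
      refine ⟨fun m hm => ?_, fun m hm => ?_⟩
      · rcases Nat.le_succ_iff.1 hm with hm | rfl
        · rw [hF'm m hm]
          exact hF.1 m hm
        · rw [hF'N, card_insert_of_notMem hSF, hcard]
          exact ⟨hS, rfl, hopt _ (ssubset_insert hSF) hsub⟩
      · rw [hF'm m (by omega)]
        rcases Nat.lt_succ_iff_lt_or_eq.1 hm with hm | rfl
        · rw [hF'm (m + 1) hm]
          exact hF.2 m hm
        · rw [hF'N]
          exact subset_insert _ _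
    obtain ⟨K, hK, hKF, hKB⟩ := ih hchain (by rwa [hF'N])
      (fun A hA hAB => hopt A ((subset_insert S _).trans_ssubset (by rwa [hF'N] at hA)) hAB)
      (by omega)
    exact ⟨K, hK, fun m hm => (hKF m (by omega)).trans (hF'm m hm), hKB⟩

theorem IsOptimalChain.exists_extend_through {X : Finset ℕ} {N : ℕ}
    {F E : ℕ → Finset (Finset ℕ)} (hF : IsOptimalChain X N F) (J : ℕ) (h0 : E 0 = F N)
    (hconv : ∀ j ≤ J, IsConvex X (E j)) (hsub : ∀ j ≤ J, ∀ i ≤ j, E i ⊆ E j)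
    (hopt : ∀ j < J, ∀ A, E j ⊂ A → A ⊆ E (j + 1) → IsOptimal X A) :
    ∃ K, IsOptimalChain X (E J).card K ∧ (∀ m ≤ N, K m = F m) ∧
      ∀ j ≤ J, K (E j).card = E j := by
  induction J with
  | zero =>
    have hc : (E 0).card = N := by rw [h0, (hF.1 N le_rfl).2.1]
    refine ⟨F, by rwa [hc], fun _ _ => rfl, fun j hj => ?_⟩
    obtain rfl : j = 0 := by omega
    rw [hc, h0]
  | succ J ih =>
    obtain ⟨K, hK, hKF, hKE⟩ := ih (fun j hj => hconv j (by omega))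
      (fun j hj => hsub j (by omega)) (fun j hj => hopt j (by omega))
    obtain ⟨L, hL, hLK, hLE⟩ := hK.exists_extend (hconv (J + 1) le_rfl)
      (by rw [hKE J le_rfl]; exact hsub (J + 1) le_rfl J (by omega))
      (by rw [hKE J le_rfl]; exact hopt J (by omega))
    have hN : N ≤ (E J).card := by
      have := card_le_card (hsub J (by omega) 0 (by omega))
      rwa [h0, (hF.1 N le_rfl).2.1] at this
    refine ⟨L, hL, fun m hm => (hLK m (hm.trans hN)).trans (hKF m hm), fun j hj => ?_⟩
    rcases Nat.le_succ_iff.1 hj with hj | rfl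
    · rw [hLK _ (card_le_card (hsub J (by omega) j hj)), hKE j hj]
    · exact hLE

theorem exists_isOptimalChain_of_card_le_one {X : Finset ℕ} (hX : X.card ≤ 1) :
    ∃ F, IsOptimalChain X (2 ^ X.card) F := by
  have hopt : ∀ F : Finset (Finset ℕ), IsOptimal X F := by
    intro F F' G' h hcard
    rcases F.eq_empty_or_nonempty with rfl | hne
    · exact card_le_card (h.2.1.trans fun B hB =>
        mem_incomparables.2 ⟨mem_powerset.1 hB, by simp⟩)
    · obtain ⟨A, hA⟩ := card_pos.1 ((card_pos.2 hne).trans_le hcard)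
      suffices G' = ∅ by simp [this]
      refine eq_empty_of_forall_notMem fun B hB => ?_
      obtain ⟨h1, h2⟩ := h.2.2 A hA B hB
      have hAX := mem_powerset.1 (h.1 hA)
      have hBX := mem_powerset.1 (h.2.1 hB)
      obtain ⟨a, haA, haB⟩ := not_subset.1 h1
      obtain ⟨b, hbB, hbA⟩ := not_subset.1 h2
      exact hbA (card_le_one.1 hX a (hAX haA) b (hBX hbB) ▸ haA)
  have h0 : IsOptimalChain X 0 fun _ => ∅ :=
    ⟨fun m hm => ⟨isConvex_empty X, by simp; omega, hopt _⟩, fun _ _ => Subset.rfl⟩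
  obtain ⟨K, hK, -⟩ := h0.exists_extend (isConvex_powerset X) (empty_subset _)
    (fun A _ _ => hopt A)
  exact ⟨K, by rwa [card_powerset] at hK⟩

theorem IsOptimalChain.mono {X : Finset ℕ} {N : ℕ} {F : ℕ → Finset (Finset ℕ)}
    (hF : IsOptimalChain X N F) {i j : ℕ} (hij : i ≤ j) (hj : j ≤ N) : F i ⊆ F j := by
  induction j, hij using Nat.le_induction with
  | base => exact Subset.rfl
  | succ j _ ih => exact (ih (by omega)).trans (hF.2 j (by omega))

theorem IsOptimalChain.image_insert {x y : ℕ} {X : Finset ℕ} {F : ℕ → Finset (Finset ℕ)}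
    (hx : x ∉ insert y X) (hy : y ∉ X) (hF : IsOptimalChain X (2 ^ X.card) F) :
    IsOptimalChain (insert x (insert y X)) (2 ^ X.card) fun m => (F m).image (insert x) := by
  have hxX : x ∉ X := fun h => hx (mem_insert_of_mem h)
  have hX' : (insert x (insert y X)).card = X.card + 2 := by
    rw [card_insert_of_notMem hx, card_insert_of_notMem hy]
  refine ⟨fun m hm => ?_, fun m hm => image_subset_image (hF.2 m hm)⟩
  obtain ⟨hconv, hcard, hopt⟩ := hF.1 m hm
  have himg : ((F m).image (insert x)).card = m := by
    rw [card_image_of_injOn, hcard]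
    intro A hA B hB h
    have hxA : x ∉ A := fun h => hxX (mem_powerset.1 (hconv.subset hA) h)
    have hxB : x ∉ B := fun h => hxX (mem_powerset.1 (hconv.subset hB) h)
    rw [← erase_insert hxA, ← erase_insert hxB]
    exact congrArg (Finset.erase · x) h
  refine ⟨hconv.image_insert hxX (insert_subset_insert _ (subset_insert _ _)), himg, ?_⟩
  intro F' G' h hle
  rw [himg] at hle
  obtain ⟨F₁, hF₁, hF₁c⟩ := exists_subset_card_eq hle
  obtain ⟨F₂, G₂, h₂, hF₂, hG₂⟩ := (h.mono_left hF₁).exists_of_card_eq_add_two hX' (by omega)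
  have h3 := hopt F₂ G₂ h₂ (by omega)
  have h4 := hconv.card_incomparables_image_insert hx hy
  dsimp only
  omega

theorem isOptimal_of_subset_coIncomparables {X : Finset ℕ} {H H' A : Finset (Finset ℕ)}
    (hH : H ⊆ X.powerset) (hH' : IsOptimal X H') (hcard : H'.card ≤ H.card + 1)
    (h1 : coIncomparables X H' ⊂ A) (h2 : A ⊆ coIncomparables X H) : IsOptimal X A := by
  intro F' G' h hle
  by_contra! hlt
  have h3 := (card_le_card_incomparables_coIncomparables hH).trans
    (card_le_card (incomparables_anti h2))
  have h4 := hH' G' F' h.symm (by omega)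
  have h5 := card_lt_card h1
  rw [card_coIncomparables] at h5
  omega

theorem IsOptimalChain.exists_insert_insert {x y : ℕ} {X : Finset ℕ}
    {F : ℕ → Finset (Finset ℕ)} (hx : x ∉ insert y X) (hy : y ∉ X)
    (hF : IsOptimalChain X (2 ^ X.card) F) :
    ∃ K, IsOptimalChain (insert x (insert y X)) (2 ^ (X.card + 2)) K ∧
      (∀ m ≤ 2 ^ X.card, K m = (F m).image (insert x)) ∧
      ∀ m ≤ 2 ^ X.card, ∃ m' ≤ 2 ^ (X.card + 2),
        K m' = coIncomparables (insert x (insert y X)) (K m) := by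
  set X' := insert x (insert y X) with hX'
  set M := 2 ^ X.card with hM
  have hcX' : X'.card = X.card + 2 := by
    rw [hX', card_insert_of_notMem hx, card_insert_of_notMem hy]
  have hH := hF.image_insert hx hy
  set H : ℕ → Finset (Finset ℕ) := fun m => (F m).image (insert x) with hHdef
  have hFM : F M = X.powerset := eq_of_subset_of_card_le (hF.1 M le_rfl).1.subset
    (by rw [card_powerset, (hF.1 M le_rfl).2.1])
  have hE0 : coIncomparables X' (H (M - 0)) = H M := by
    simp only [hHdef, Nat.sub_zero, hFM]
    exact coIncomparables_image_insert_powerset hx hy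
  obtain ⟨K, hK, hKH, hKE⟩ := hH.exists_extend_through
    (E := fun j => coIncomparables X' (H (M - j))) M hE0
    (fun j _ => isConvex_coIncomparables _ _)
    (fun j hj i hi => coIncomparables_anti (hH.mono (by omega) (by omega)))
    (fun j hj A h1 h2 => isOptimal_of_subset_coIncomparables
      (hH.1 (M - (j + 1)) (by omega)).1.subset (hH.1 (M - j) (by omega)).2.2
      (by rw [(hH.1 (M - (j + 1)) (by omega)).2.1, (hH.1 (M - j) (by omega)).2.1]; omega) h1 h2)
  have hH0 : H (M - M) = ∅ := by
    rw [Nat.sub_self, ← card_eq_zero, (hH.1 0 (Nat.zero_le _)).2.1]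
  have hEM : (coIncomparables X' (H (M - M))).card = 2 ^ (X.card + 2) := by
    rw [hH0, coIncomparables_empty, card_powerset, hcX']
  simp only [hEM] at hK
  refine ⟨K, hK, hKH, fun m hm => ⟨(coIncomparables X' (H m)).card, ?_, ?_⟩⟩
  · rw [← hcX', ← card_powerset]
    exact card_le_card (filter_subset _ _)
  · rw [hKH m hm]
    have := hKE (M - m) (by omega)
    rwa [Nat.sub_sub_self hm] at this

/-! ### Intervals as ground sets -/

/-- The sets lying between the first `k` and the first `n - k` elements of `{l + 1, …, l + n}`. -/
def middleCube (l n k : ℕ) : Finset (Finset ℕ) :=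
  (Icc (l + 1) (l + n)).powerset.filter
    fun A => Icc (l + 1) (l + k) ⊆ A ∧ A ⊆ Icc (l + 1) (l + (n - k))

theorem Icc_eq_insert_insert (l n : ℕ) :
    Icc (l + 1) (l + (n + 2)) =
      insert (l + 1) (insert (l + n + 2) (Icc (l + 1 + 1) (l + 1 + n))) := by
  ext a
  simp only [mem_insert, mem_Icc]
  omega

theorem image_insert_middleCube {l n k : ℕ} (hk : k ≤ n) :
    (middleCube (l + 1) n k).image (insert (l + 1)) = middleCube l (n + 2) (k + 1) := by
  ext B
  simp only [middleCube, mem_image, mem_filter, mem_powerset]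
  constructor
  · rintro ⟨A, ⟨h1, h2, h3⟩, rfl⟩
    refine ⟨fun a ha => ?_, fun a ha => ?_, fun a ha => ?_⟩
    · rcases mem_insert.1 ha with rfl | ha
      · simp
      · have := mem_Icc.1 (h1 ha)
        rw [mem_Icc]
        omega
    · rw [mem_Icc] at ha
      by_cases h : a = l + 1
      · exact mem_insert.2 (Or.inl h)
      · exact mem_insert_of_mem (h2 (mem_Icc.2 (by omega)))
    · rcases mem_insert.1 ha with rfl | ha
      · rw [mem_Icc]
        omega
      · have := mem_Icc.1 (h3 ha)
        rw [mem_Icc]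
        omega
  · rintro ⟨h1, h2, h3⟩
    refine ⟨B.erase (l + 1), ⟨fun a ha => ?_, fun a ha => ?_, fun a ha => ?_⟩, insert_erase
      (h2 (mem_Icc.2 (by omega)))⟩
    · rw [mem_erase] at ha
      have := mem_Icc.1 (h3 ha.2)
      rw [mem_Icc]
      omega
    · rw [mem_Icc] at ha
      exact mem_erase.2 ⟨by omega, h2 (mem_Icc.2 (by omega))⟩
    · rw [mem_erase] at ha
      have := mem_Icc.1 (h3 ha.2)
      rw [mem_Icc]
      omega

theorem middleCube_zero (l n : ℕ) : middleCube l n 0 = (Icc (l + 1) (l + n)).powerset :=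
  filter_true_of_mem fun A hA => ⟨by simp, mem_powerset.1 hA⟩

theorem exists_isOptimalChain_Icc (n l : ℕ) :
    ∃ F, IsOptimalChain (Icc (l + 1) (l + n)) (2 ^ n) F ∧
      ∀ k, 1 ≤ k → 2 * k ≤ n → ∃ m ≤ 2 ^ n, F m = middleCube l n k ∧
        ∃ m' ≤ 2 ^ n, F m' = coIncomparables (Icc (l + 1) (l + n)) (F m) := by
  have hcard : ∀ l n, (Icc (l + 1) (l + n)).card = n := fun l n => by
    rw [Nat.card_Icc]
    omega
  have hsmall : ∀ l n, n ≤ 1 → ∃ F, IsOptimalChain (Icc (l + 1) (l + n)) (2 ^ n) F ∧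
      ∀ k, 1 ≤ k → 2 * k ≤ n → ∃ m ≤ 2 ^ n, F m = middleCube l n k ∧
        ∃ m' ≤ 2 ^ n, F m' = coIncomparables (Icc (l + 1) (l + n)) (F m) := by
    intro l n hn
    obtain ⟨F, hF⟩ := exists_isOptimalChain_of_card_le_one ((hcard l n).trans_le hn)
    rw [hcard] at hF
    exact ⟨F, hF, fun k h1 h2 => by omega⟩
  induction n using Nat.twoStepInduction generalizing l with
  | zero => exact hsmall l 0 (by omega)
  | one => exact hsmall l 1 le_rfl
  | more n ih _ =>
    obtain ⟨F, hF, hFC⟩ := ih (l + 1)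
    have hX := hcard (l + 1) n
    obtain ⟨K, hK, hKF, hKc⟩ := IsOptimalChain.exists_insert_insert (x := l + 1) (y := l + n + 2)
      (X := Icc (l + 1 + 1) (l + 1 + n)) (by simp; omega) (by simp; omega) (by rwa [hX])
    rw [← Icc_eq_insert_insert] at hK hKc
    rw [hX] at hK hKF hKc
    refine ⟨K, hK, fun k hk1 hk2 => ?_⟩
    obtain ⟨k, rfl⟩ := Nat.exists_eq_add_of_le' hk1
    obtain ⟨m, hm, hFm⟩ : ∃ m ≤ 2 ^ n, F m = middleCube (l + 1) n k := by
      rcases Nat.eq_zero_or_pos k with rfl | hk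
      · refine ⟨2 ^ n, le_rfl, ?_⟩
        rw [middleCube_zero]
        obtain ⟨hc, hc', -⟩ := hF.1 _ le_rfl
        exact eq_of_subset_of_card_le hc.subset (by rw [card_powerset, hX, hc'])
      · obtain ⟨m, hm, hFm, -⟩ := hFC k hk (by omega)
        exact ⟨m, hm, hFm⟩
    refine ⟨m, hm.trans (Nat.pow_le_pow_right (by omega) (by omega)), ?_, hKc m hm⟩
    rw [hKF m hm, hFm, image_insert_middleCube (by omega)]

theorem coIncomparables_middleCube {n k : ℕ} (hk : 2 * k ≤ n) :
    coIncomparables (Icc (0 + 1) (0 + n)) (middleCube 0 n k) =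
      (groundSet n).powerset.filter
        fun A => ¬ A ⊆ Icc (k + 1) n ∧ ¬ Icc (n - k + 1) n ⊆ A := by
  ext B
  simp only [mem_coIncomparables, mem_filter, mem_powerset, groundSet, middleCube, zero_add]
  refine and_congr_right fun hB => ⟨fun h => ⟨fun h' => ?_, fun h' => ?_⟩, ?_⟩
  · refine (h (Icc 1 k) ⟨Icc_subset_Icc_right (by omega), Subset.rfl,
      Icc_subset_Icc_right (by omega)⟩).1 fun a ha => ?_
    rw [mem_Icc] at ha
    refine mem_sdiff.2 ⟨mem_Icc.2 (by omega), fun haB => ?_⟩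
    have := mem_Icc.1 (h' haB)
    omega
  · refine (h (Icc 1 (n - k)) ⟨Icc_subset_Icc_right (by omega), Icc_subset_Icc_right (by omega),
      Subset.rfl⟩).2 fun a ha => ?_
    rw [mem_sdiff, mem_Icc] at ha
    refine mem_Icc.2 ⟨ha.1.1, ?_⟩
    by_contra hlt
    exact ha.2 (h' (mem_Icc.2 (by omega)))
  · rintro ⟨h1, h2⟩ A ⟨-, hA1, hA2⟩
    refine ⟨fun h => h1 fun a ha => ?_, fun h => h2 fun a ha => ?_⟩
    · have haX := mem_Icc.1 (hB ha)
      refine mem_Icc.2 ⟨?_, haX.2⟩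
      by_contra hlt
      exact (mem_sdiff.1 (h (hA1 (mem_Icc.2 (by omega))))).2 ha
    · rw [mem_Icc] at ha
      by_contra haB
      have := mem_Icc.1 (hA2 (h (mem_sdiff.2 ⟨mem_Icc.2 (by omega), haB⟩)))
      omega

/-- Theorem 4: there is a chain `𝓕₀ ⊊ ⋯ ⊊ 𝓕_{2^n}` of convex families of subsets of `[n]`
with `|𝓕ₘ| = m` and `|(𝓕ₘ)↕| = Φ(n,m)` for each `m`, which moreover includes the
families `𝒞_{n,a}` and `𝒞*_{n,a}` for each `a ∈ {0,…,n-2}` with `a ≡ n (mod 2)`. -/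
theorem stmt3 (n : ℕ) :
    ∃ F : ℕ → Finset (Finset ℕ),
      (∀ m, m ≤ 2 ^ n → F m ⊆ (groundSet n).powerset ∧ (F m).card = m ∧
        IsConvex (groundSet n) (F m) ∧ (udClo (groundSet n) (F m)).card = Phi n m) ∧
      (∀ m, m < 2 ^ n → F m ⊂ F (m + 1)) ∧
      (∀ a, a + 2 ≤ n → a % 2 = n % 2 →
        (∃ m ≤ 2 ^ n, F m = Cfam n a) ∧ (∃ m ≤ 2 ^ n, F m = CfamStar n a)) := by
  obtain ⟨F, hF, hFC⟩ := exists_isOptimalChain_Icc n 0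
  have hX : Icc (0 + 1) (0 + n) = groundSet n := by rw [groundSet, zero_add, zero_add]
  rw [hX] at hF
  refine ⟨F, fun m hm => ?_, fun m hm => ?_, fun a ha hmod => ?_⟩
  · obtain ⟨hconv, hcard, hopt⟩ := hF.1 m hm
    refine ⟨hconv.subset, hcard, hconv, ?_⟩
    rw [hopt.card_udClo_eq hconv.subset, hcard]
  · refine (hF.2 m hm).ssubset_of_ne fun h => ?_
    have h1 := (hF.1 m hm.le).2.1
    rw [h, (hF.1 (m + 1) hm).2.1] at h1
    omega
  · obtain ⟨m, hm, hFm, m', hm', hFm'⟩ := hFC ((n - a) / 2) (by omega) (by omega)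
    have hna : (n + a) / 2 = n - (n - a) / 2 := by omega
    refine ⟨⟨m, hm, ?_⟩, m', hm', ?_⟩
    · simp only [hFm, middleCube, Cfam, groundSet, zero_add, hna]
    · rw [hFm', hFm, coIncomparables_middleCube (by omega), CfamStar, hna]
end

section
/- Let n and m be nonnegative integers with m ≤ 2^n. There exists a family 𝓕 of subsets of [n] with |𝓕| = m and |𝓕↕| = Φ(n,m) that is convex. -/
open Finset

theorem subset_upClo {X : Finset ℕ} {F : Finset (Finset ℕ)} (hF : F ⊆ X.powerset) :
    F ⊆ upClo X F := fun A hA => by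
  simpa [upClo] using ⟨mem_powerset.1 (hF hA), A, hA, Subset.rfl⟩

theorem subset_downClo {X : Finset ℕ} {F : Finset (Finset ℕ)} (hF : F ⊆ X.powerset) :
    F ⊆ downClo X F := fun A hA => by
  simpa [downClo] using ⟨mem_powerset.1 (hF hA), A, hA, Subset.rfl⟩

theorem upClo_mono {X : Finset ℕ} {F G : Finset (Finset ℕ)} (h : F ⊆ G) :
    upClo X F ⊆ upClo X G := by
  refine monotone_filter_right _ ?_
  rintro S _ ⟨A, hA, hAS⟩
  exact ⟨A, h hA, hAS⟩

theorem downClo_mono {X : Finset ℕ} {F G : Finset (Finset ℕ)} (h : F ⊆ G) :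
    downClo X F ⊆ downClo X G := by
  refine monotone_filter_right _ ?_
  rintro S _ ⟨A, hA, hAS⟩
  exact ⟨A, h hA, hAS⟩

theorem udClo_mono {X : Finset ℕ} {F G : Finset (Finset ℕ)} (h : F ⊆ G) :
    udClo X F ⊆ udClo X G :=
  union_subset_union (upClo_mono h) (downClo_mono h)

theorem upClo_idem (X : Finset ℕ) (F : Finset (Finset ℕ)) :
    upClo X (upClo X F) ⊆ upClo X F := by
  intro S hS
  obtain ⟨hSX, B, hB, hBS⟩ := mem_filter.1 hS
  obtain ⟨-, A, hA, hAB⟩ := mem_filter.1 hB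
  exact mem_filter.2 ⟨hSX, A, hA, hAB.trans hBS⟩

theorem downClo_idem (X : Finset ℕ) (F : Finset (Finset ℕ)) :
    downClo X (downClo X F) ⊆ downClo X F := by
  intro S hS
  obtain ⟨hSX, B, hB, hSB⟩ := mem_filter.1 hS
  obtain ⟨-, A, hA, hBA⟩ := mem_filter.1 hB
  exact mem_filter.2 ⟨hSX, A, hA, hSB.trans hBA⟩

/-- The convex hull `𝓕↑ ∩ 𝓕↓` of a family. -/
def convHull (X : Finset ℕ) (F : Finset (Finset ℕ)) : Finset (Finset ℕ) :=
  upClo X F ∩ downClo X F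

theorem subset_convHull {X : Finset ℕ} {F : Finset (Finset ℕ)} (hF : F ⊆ X.powerset) :
    F ⊆ convHull X F :=
  subset_inter (subset_upClo hF) (subset_downClo hF)

theorem convHull_subset_powerset (X : Finset ℕ) (F : Finset (Finset ℕ)) :
    convHull X F ⊆ X.powerset :=
  inter_subset_left.trans (filter_subset _ _)

theorem upClo_convHull_subset (X : Finset ℕ) (F : Finset (Finset ℕ)) :
    upClo X (convHull X F) ⊆ upClo X F :=
  (upClo_mono inter_subset_left).trans (upClo_idem X F)

theorem downClo_convHull_subset (X : Finset ℕ) (F : Finset (Finset ℕ)) :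
    downClo X (convHull X F) ⊆ downClo X F :=
  (downClo_mono inter_subset_right).trans (downClo_idem X F)

theorem udClo_convHull_subset (X : Finset ℕ) (F : Finset (Finset ℕ)) :
    udClo X (convHull X F) ⊆ udClo X F :=
  union_subset_union (upClo_convHull_subset X F) (downClo_convHull_subset X F)

theorem isConvex_convHull (X : Finset ℕ) (F : Finset (Finset ℕ)) :
    IsConvex X (convHull X F) :=
  (inter_subset_inter (upClo_convHull_subset X F) (downClo_convHull_subset X F)).antisymm
    (subset_convHull (convHull_subset_powerset X F))

/-- Removing a minimal member preserves convexity. -/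
theorem IsConvex.erase_minimal {X : Finset ℕ} {C : Finset (Finset ℕ)} (hC : IsConvex X C)
    {A : Finset ℕ} (hA : Minimal (· ∈ C) A) : IsConvex X (C.erase A) := by
  have hCX : C ⊆ X.powerset := hC ▸ convHull_subset_powerset X C
  refine Subset.antisymm ?_ (subset_convHull ((erase_subset _ _).trans hCX))
  intro S hS
  refine mem_erase.2 ⟨?_, ?_⟩
  · rintro rfl
    obtain ⟨-, B, hB, hBS⟩ := mem_filter.1 (mem_inter.1 hS).1
    rw [mem_erase] at hB
    exact hB.1 (hBS.antisymm (hA.2 hB.2 hBS))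
  · have h := inter_subset_inter (upClo_mono (X := X) (erase_subset A C))
      (downClo_mono (X := X) (erase_subset A C)) hS
    rwa [hC] at h

/-- A convex family has convex subfamilies of every smaller cardinality. -/
theorem IsConvex.exists_subset_card_eq {X : Finset ℕ} {C : Finset (Finset ℕ)}
    (hC : IsConvex X C) {m : ℕ} (hm : m ≤ C.card) :
    ∃ G ⊆ C, G.card = m ∧ IsConvex X G := by
  induction hm using Nat.decreasingInduction with
  | self => exact ⟨C, Subset.rfl, rfl, hC⟩
  | of_succ k _ ih =>
    obtain ⟨G, hGC, hcard, hG⟩ := ih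
    obtain ⟨A, hA⟩ := G.exists_minimal (card_pos.1 (by omega))
    refine ⟨G.erase A, (erase_subset _ _).trans hGC, ?_, hG.erase_minimal hA⟩
    rw [card_erase_of_mem hA.1, hcard, Nat.add_sub_cancel]

/-- Lemma 6: there exists a convex `(n,m)`-witness family, i.e. a convex family
`𝓕 ⊆ 2^[n]` with `|𝓕| = m` and `|𝓕↕| = Φ(n,m)`. -/
theorem stmt5 (n m : ℕ) (hm : m ≤ 2 ^ n) :
    ∃ F : Finset (Finset ℕ), F ⊆ (groundSet n).powerset ∧ F.card = m ∧
      (udClo (groundSet n) F).card = Phi n m ∧ IsConvex (groundSet n) F := by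
  obtain ⟨F, hF, hFm, hFk⟩ : Phi n m ∈ {k | ∃ F : Finset (Finset ℕ),
      F ⊆ (groundSet n).powerset ∧ F.card = m ∧ (udClo (groundSet n) F).card = k} := by
    obtain ⟨F, hF, hFm⟩ := Finset.exists_subset_card_eq (s := (groundSet n).powerset) (n := m)
      (by simpa [groundSet] using hm)
    exact Nat.sInf_mem ⟨_, F, hF, hFm, rfl⟩
  obtain ⟨G, hG, hGm, hGc⟩ := (isConvex_convHull (groundSet n) F).exists_subset_card_eq
    (hFm ▸ card_le_card (subset_convHull hF))
  have hGX := hG.trans (convHull_subset_powerset _ _)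
  refine ⟨G, hGX, hGm, le_antisymm ?_ (Nat.sInf_le ⟨G, hGX, hGm, rfl⟩), hGc⟩
  rw [← hFk]
  exact card_le_card ((udClo_mono hG).trans (udClo_convHull_subset _ _))
end
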